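/- Let G be a simple graph on a finite vertex type α with at least two vertices in which every vertex has even degree. Let u be a vertex of maximum degree, set d₁ := deg(u) (so d₁ = Δ(G), which is even), and set d₂ := max over vertices v ≠ u of deg(v) (the second-largest entry of the degree sequence). Then G admits a cycle odd-cover of size at most d₁/2 + ⌈d₂/4⌉. In particular, G admits a cycle odd-cover of size at most ⌈3Δ(G)/4⌉. -/

import Mathlib

/-- The degree of a vertex, as the cardinality of its neighbor set. -/
noncomputable def degS {α : Type*} (G : SimpleGraph α) (v : α) : ℕ := (G.neighborSet v).ncard

/-- A polycycle: every vertex has degree 0 or 2 (every component is a cycle). -/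
def IsPolycycle {α : Type*} (G : SimpleGraph α) : Prop :=
  ∀ v, degS G v = 0 ∨ degS G v = 2

/-- A cycle graph: a nonempty connected graph in which every non-isolated vertex
has degree 2. -/
def IsCycleGraph {α : Type*} (G : SimpleGraph α) : Prop :=
  G ≠ ⊥ ∧ (∀ v, degS G v = 0 ∨ degS G v = 2) ∧
    ∀ u v, 0 < degS G u → 0 < degS G v → G.Reachable u v

/-- A path graph: a graph whose edge set forms a nontrivial path. -/
def IsPathGraph {α : Type*} (G : SimpleGraph α) : Prop :=
  G ≠ ⊥ ∧ G.IsAcyclic ∧ (∀ v, degS G v ≤ 2) ∧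
    ∀ u v, 0 < degS G u → 0 < degS G v → G.Reachable u v

/-- A linear forest: an acyclic graph of maximum degree at most 2. -/
def IsLinearForest {α : Type*} (G : SimpleGraph α) : Prop :=
  G.IsAcyclic ∧ ∀ v, degS G v ≤ 2

/-- The symmetric difference of a family (list) of graphs: an edge belongs to it
iff it belongs to an odd number of members. -/
def listSymmDiff {α : Type*} (L : List (SimpleGraph α)) : SimpleGraph α :=
  L.foldr symmDiff ⊥

namespace CycleOddCover

open SimpleGraph

variable {α : Type*}

section Degree

theorem degS_eq_zero [Finite α] {G : SimpleGraph α} {v : α} :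
    degS G v = 0 ↔ ∀ w, ¬ G.Adj v w := by
  unfold degS
  rw [Set.ncard_eq_zero (Set.toFinite _), Set.eq_empty_iff_forall_notMem]
  rfl

theorem degS_pos [Finite α] {G : SimpleGraph α} {v : α} :
    0 < degS G v ↔ ∃ w, G.Adj v w := by
  rw [Nat.pos_iff_ne_zero, Ne, degS_eq_zero]; push Not; rfl

theorem degS_pos_of_adj [Finite α] {G : SimpleGraph α} {v w : α} (h : G.Adj v w) :
    0 < degS G v := degS_pos.2 ⟨w, h⟩

theorem degS_mono [Finite α] {G H : SimpleGraph α} (h : G ≤ H) (v : α) : degS G v ≤ degS H v :=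
  Set.ncard_le_ncard (fun _ hw => h hw) (Set.toFinite _)

theorem degS_bot (v : α) : degS (⊥ : SimpleGraph α) v = 0 := by
  simp [degS]

theorem degS_eq_one {G : SimpleGraph α} {v : α} :
    degS G v = 1 ↔ ∃ w, ∀ x, G.Adj v x ↔ x = w := by
  unfold degS
  rw [Set.ncard_eq_one]
  simp [Set.ext_iff]

theorem degS_eq_two {G : SimpleGraph α} {v : α} :
    degS G v = 2 ↔ ∃ a b, a ≠ b ∧ ∀ x, G.Adj v x ↔ x = a ∨ x = b := by
  unfold degS
  rw [Set.ncard_eq_two]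
  simp [Set.ext_iff]

theorem two_le_degS [Finite α] {G : SimpleGraph α} {v a b : α} (ha : G.Adj v a) (hb : G.Adj v b)
    (hab : a ≠ b) : 2 ≤ degS G v := by
  have : 1 < (G.neighborSet v).ncard := (Set.one_lt_ncard (Set.toFinite _)).2 ⟨a, ha, b, hb, hab⟩
  exact this

theorem eq_of_degS_le_one [Finite α] {G : SimpleGraph α} {v a b : α} (h : degS G v ≤ 1)
    (ha : G.Adj v a) (hb : G.Adj v b) : a = b := by
  by_contra hab
  have := two_le_degS ha hb hab
  omega

theorem degS_sup [Finite α] {G H : SimpleGraph α} (h : Disjoint G H) (v : α) :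
    degS (G ⊔ H) v = degS G v + degS H v := by
  unfold degS
  rw [show (G ⊔ H).neighborSet v = G.neighborSet v ∪ H.neighborSet v from rfl,
    Set.ncard_union_eq _ (Set.toFinite _) (Set.toFinite _)]
  rw [Set.disjoint_left]
  intro w h1 h2
  exact (h.le_bot : G ⊓ H ≤ ⊥) (show (G ⊓ H).Adj v w from ⟨h1, h2⟩)

theorem degS_sdiff_add [Finite α] {G H : SimpleGraph α} (h : H ≤ G) (v : α) :
    degS (G \ H) v + degS H v = degS G v := by
  rw [← degS_sup disjoint_sdiff_self_left, sdiff_sup_cancel h]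

open Classical in
theorem degS_edge [Finite α] {p q : α} (h : p ≠ q) (v : α) :
    degS (edge p q) v = if v = p ∨ v = q then 1 else 0 := by
  split_ifs with hv
  · rw [degS_eq_one]
    rcases hv with rfl | rfl
    · exact ⟨q, fun x => by simp only [edge_adj]; grind⟩
    · exact ⟨p, fun x => by simp only [edge_adj]; grind⟩
  · rw [degS_eq_zero]
    intro w
    simp only [edge_adj]; grind

theorem disjoint_edge {G : SimpleGraph α} {p q : α} (h : ¬ G.Adj p q) : Disjoint G (edge p q) := by
  rw [disjoint_iff_inf_le]
  intro a b hab
  simp only [inf_adj, edge_adj] at hab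
  rcases hab with ⟨h1, ⟨rfl, rfl⟩ | ⟨rfl, rfl⟩, _⟩
  · exact h h1
  · exact h h1.symm

open Classical in
theorem degS_add_edge [Finite α] {G : SimpleGraph α} {p q : α} (hpq : p ≠ q) (h : ¬ G.Adj p q)
    (v : α) : degS (G ⊔ edge p q) v = degS G v + if v = p ∨ v = q then 1 else 0 := by
  rw [degS_sup (disjoint_edge h), degS_edge hpq]

theorem reachable_add_edge {G : SimpleGraph α} {p q u v : α} (hpq : p ≠ q) :
    (G ⊔ edge p q).Reachable u v ↔ G.Reachable u v ∨ (G.Reachable u p ∧ G.Reachable q v) ∨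
      (G.Reachable u q ∧ G.Reachable p v) := by
  constructor
  · rintro ⟨w⟩
    induction w with
    | nil => exact Or.inl .rfl
    | @cons u u' v h w ih =>
      rw [sup_adj, edge_adj] at h
      rcases h with h | ⟨⟨rfl, rfl⟩ | ⟨rfl, rfl⟩, _⟩
      · have := h.reachable
        rcases ih with ih | ⟨h1, h2⟩ | ⟨h1, h2⟩
        · exact Or.inl (this.trans ih)
        · exact Or.inr (Or.inl ⟨this.trans h1, h2⟩)
        · exact Or.inr (Or.inr ⟨this.trans h1, h2⟩)
      · rcases ih with ih | ⟨h1, h2⟩ | ⟨h1, h2⟩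
        · exact Or.inr (Or.inl ⟨.rfl, ih⟩)
        · exact Or.inr (Or.inl ⟨.rfl, h2⟩)
        · exact Or.inl h2
      · rcases ih with ih | ⟨h1, h2⟩ | ⟨h1, h2⟩
        · exact Or.inr (Or.inr ⟨.rfl, ih⟩)
        · exact Or.inl h2
        · exact Or.inr (Or.inr ⟨.rfl, h2⟩)
  · have hle : G ≤ G ⊔ edge p q := le_sup_left
    have he : (G ⊔ edge p q).Reachable p q := by
      apply Adj.reachable
      rw [sup_adj, edge_adj]
      exact Or.inr ⟨Or.inl ⟨rfl, rfl⟩, hpq⟩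
    rintro (h | ⟨h1, h2⟩ | ⟨h1, h2⟩)
    · exact h.mono hle
    · exact ((h1.mono hle).trans he).trans (h2.mono hle)
    · exact ((h1.mono hle).trans he.symm).trans (h2.mono hle)

theorem sdiff_edge_sup {G : SimpleGraph α} {p q : α} (h : G.Adj p q) :
    G \ edge p q ⊔ edge p q = G :=
  sdiff_sup_cancel (by rw [edge_le_iff]; exact Or.inr h)

theorem not_adj_sdiff_edge {G : SimpleGraph α} {p q : α} (h : p ≠ q) :
    ¬ (G \ edge p q).Adj p q := by
  rw [sdiff_adj, edge_adj]; tauto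

theorem exists_adj_of_ne_bot {G : SimpleGraph α} (h : G ≠ ⊥) : ∃ p q, G.Adj p q := by
  by_contra! hn
  exact h (eq_bot_iff.2 fun p q hpq => (hn p q hpq).elim)

theorem not_reachable_sdiff_edge {G : SimpleGraph α} (hG : G.IsAcyclic) {p q : α}
    (h : G.Adj p q) : ¬ (G \ edge p q).Reachable p q := by
  exact isAcyclic_iff_forall_adj_isBridge.1 hG h

end Degree

section LinearForest

theorem acyclic_induction [Finite α] {motive : SimpleGraph α → Prop} (bot : motive ⊥)
    (insert : ∀ F p q, p ≠ q → F.IsAcyclic → ¬ F.Reachable p q → motive F → motive (F ⊔ edge p q))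
    (F : SimpleGraph α) (hF : F.IsAcyclic) : motive F := by
  induction F using WellFoundedLT.induction with
  | ind F ih =>
    by_cases hb : F = ⊥
    · exact hb ▸ bot
    · obtain ⟨p, q, hpq⟩ := exists_adj_of_ne_bot hb
      have hlt : F \ edge p q < F :=
        lt_of_le_of_ne sdiff_le fun h =>
          not_adj_sdiff_edge hpq.ne (h.symm ▸ hpq : (F \ edge p q).Adj p q)
      have := insert (F \ edge p q) p q hpq.ne (hF.anti sdiff_le) (not_reachable_sdiff_edge hF hpq)
        (ih _ hlt (hF.anti sdiff_le))
      rwa [sdiff_edge_sup hpq] at this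

open Classical in
theorem defect_sum [Fintype α] (F : SimpleGraph α) (hF : F.IsAcyclic) :
    ∀ v, ∑ w, (if F.Reachable v w then (2 - degS F w : ℤ) else 0) = 2 := by
  refine acyclic_induction (motive := fun F => ∀ v, ∑ w,
    (if F.Reachable v w then (2 - degS F w : ℤ) else 0) = 2) ?_ ?_ F hF
  · intro v
    simp [degS_bot, reachable_bot]
  · intro F p q hpq hF hr ih v
    have hadj : ¬ F.Adj p q := fun h => hr h.reachable
    have key : ∀ a b, a ≠ b → ¬ F.Reachable a b → F.Reachable v a →
        ∑ w, (if F.Reachable v w ∨ F.Reachable b w then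
          (2 - (degS F w + if w = a ∨ w = b then 1 else 0 : ℕ) : ℤ) else 0) = 2 := by
      intro a b hab hr hva
      have h1 := ih a
      have h2 := ih b
      have h3 : ∑ w, (if w = a then (1:ℤ) else 0) = 1 := by simp
      have h4 : ∑ w, (if w = b then (1:ℤ) else 0) = 1 := by simp
      have h5 : (2 : ℤ) = 2 + 2 - 1 - 1 := by norm_num
      refine Eq.trans ?_ ((congrArg₂ (· - ·) (congrArg₂ (· - ·)
        (congrArg₂ (· + ·) h1 h2) h3) h4).trans h5.symm)
      rw [← Finset.sum_add_distrib, ← Finset.sum_sub_distrib, ← Finset.sum_sub_distrib]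
      refine Finset.sum_congr rfl fun w _ => ?_
      have e1 : F.Reachable v w ↔ F.Reachable a w :=
        ⟨fun h => hva.symm.trans h, fun h => hva.trans h⟩
      have e2 : ¬ (F.Reachable a w ∧ F.Reachable b w) := fun h => hr (h.1.trans h.2.symm)
      have e3 : w = a → F.Reachable a w := fun h => h ▸ .rfl
      have e4 : w = b → F.Reachable b w := fun h => h ▸ .rfl
      simp only [e1]
      clear e1 h1 h2 h3 h4 h5 ih
      push_cast
      by_cases hwa : w = a
      · subst hwa
        simp only [e3 rfl, hab, true_or, if_true, if_false]
        have : ¬ F.Reachable b w := fun h => e2 ⟨e3 rfl, h⟩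
        simp only [this, if_false]; ring
      · by_cases hwb : w = b
        · subst hwb
          have : ¬ F.Reachable a w := fun h => e2 ⟨h, e4 rfl⟩
          simp only [this, e4 rfl, hwa, false_or, if_true, if_false]; ring
        · simp only [hwa, hwb, or_self, if_false]
          by_cases ha : F.Reachable a w
          · have : ¬ F.Reachable b w := fun h => e2 ⟨ha, h⟩
            simp [ha, this]
          · simp [ha]
    simp only [degS_add_edge hpq hadj, reachable_add_edge hpq]
    by_cases hp : F.Reachable v p
    · refine (Finset.sum_congr rfl fun w _ => ?_).trans (key p q hpq hr hp)
      have : ¬ F.Reachable v q := fun h => hr (hp.symm.trans h)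
      simp [hp, this]
    · by_cases hq : F.Reachable v q
      · refine (Finset.sum_congr rfl fun w _ => ?_).trans (key q p hpq.symm (fun h => hr h.symm) hq)
        simp [hp, hq, or_comm]
      · refine (Finset.sum_congr rfl fun w _ => ?_).trans (ih v)
        by_cases hw : F.Reachable v w
        · have h1 : w ≠ p := fun h => hp (h ▸ hw)
          have h2 : w ≠ q := fun h => hq (h ▸ hw)
          simp [hw, h1, h2]
        · simp [hp, hq, hw]

theorem eq_of_reachable_of_degS_eq_zero [Finite α] {F : SimpleGraph α} {v w : α} (h : degS F v = 0)
    (hr : F.Reachable v w) : v = w := by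
  obtain ⟨p⟩ := hr
  cases p with
  | nil => rfl
  | cons hadj _ => exact (degS_eq_zero.1 h _ hadj).elim

theorem degS_pos_of_reachable_ne [Finite α] {F : SimpleGraph α} {v w : α} (hne : v ≠ w)
    (hr : F.Reachable v w) : 0 < degS F v :=
  Nat.pos_of_ne_zero fun h => hne (eq_of_reachable_of_degS_eq_zero h hr)

variable {F G : SimpleGraph α}

theorem linearForest_mono [Finite α] (h : F ≤ G) (hG : IsLinearForest G) : IsLinearForest F :=
  ⟨hG.1.anti h, fun v => (degS_mono h v).trans (hG.2 v)⟩

theorem exists_end [Finite α] (hF : IsLinearForest F) (v : α) :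
    ∃ w, F.Reachable v w ∧ degS F w ≤ 1 := by
  classical
  have := Fintype.ofFinite α
  by_contra! h
  have h2 := defect_sum F hF.1 v
  rw [Finset.sum_eq_zero] at h2
  · omega
  · intro w _
    split_ifs with hw
    · have := h w hw
      have := hF.2 w
      omega
    · rfl

theorem exists_end_of_pos [Finite α] (hF : IsLinearForest F) {v : α} (hv : 0 < degS F v) :
    ∃ w, F.Reachable v w ∧ degS F w = 1 := by
  obtain ⟨w, hw, h1⟩ := exists_end hF v
  refine ⟨w, hw, ?_⟩
  by_contra hne
  have h0 : degS F w = 0 := by omega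
  have := eq_of_reachable_of_degS_eq_zero h0 hw.symm
  subst this
  omega

theorem exists_partner [Finite α] (hF : IsLinearForest F) {v : α} (hv : degS F v = 1) :
    ∃ w, w ≠ v ∧ F.Reachable v w ∧ degS F w = 1 := by
  classical
  have := Fintype.ofFinite α
  by_contra! h
  have h2 := defect_sum F hF.1 v
  rw [Finset.sum_eq_single v] at h2
  · simp [hv] at h2
  · intro w _ hwv
    split_ifs with hw
    · have h1 := h w hwv hw
      have := hF.2 w
      have := degS_pos_of_reachable_ne hwv hw.symm
      omega
    · rfl
  · simp

theorem eq_of_three_ends [Finite α] (hF : IsLinearForest F) {a b c : α} (ha : degS F a ≤ 1)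
    (hb : degS F b ≤ 1)
    (hc : degS F c ≤ 1) (hab : a ≠ b) (hac : a ≠ c) (rab : F.Reachable a b)
    (rac : F.Reachable a c) : b = c := by
  classical
  have := Fintype.ofFinite α
  by_contra hbc
  have h2 := defect_sum F hF.1 a
  have h3 : ∑ w ∈ ({a, b, c} : Finset α), (if F.Reachable a w then (2 - degS F w : ℤ) else 0) ≤
      ∑ w, (if F.Reachable a w then (2 - degS F w : ℤ) else 0) := by
    refine Finset.sum_le_sum_of_subset_of_nonneg (Finset.subset_univ _) fun w _ _ => ?_
    split_ifs
    · have := hF.2 w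
      omega
    · rfl
  rw [h2, Finset.sum_insert (by simp [hab, hac]), Finset.sum_insert (by simp [hbc]),
    Finset.sum_singleton, if_pos .rfl, if_pos rab, if_pos rac] at h3
  omega

theorem linearForest_join [Finite α] (hF : IsLinearForest F) {p q : α} (hp : degS F p ≤ 1)
    (hq : degS F q ≤ 1)
    (hr : ¬ F.Reachable p q) : IsLinearForest (F ⊔ edge p q) := by
  classical
  refine ⟨hF.1.sup_edge_of_not_reachable hr, fun v => ?_⟩
  have hpq : p ≠ q := fun h => hr (h ▸ .rfl)
  rw [degS_add_edge hpq fun h => hr h.reachable]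
  split_ifs with h
  · rcases h with rfl | rfl <;> omega
  · simpa using hF.2 v

/-- In a linear forest whose only vertices of degree one are `p` and `q`, all edges lie on the path
between `p` and `q`. -/
theorem isCycleGraph_close [Finite α] (hF : IsLinearForest F) {p q : α} (hpq : p ≠ q)
    (hp : degS F p = 1)
    (hq : degS F q = 1) (honly : ∀ v, degS F v = 1 → v = p ∨ v = q) (h2 : ∃ z, degS F z = 2) :
    ¬ F.Adj p q ∧ IsCycleGraph (F ⊔ edge p q) := by
  classical
  have hR : ∀ v, 0 < degS F v → F.Reachable p v := by
    obtain ⟨p', hp', hpp', hp1⟩ := exists_partner hF hp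
    have : p' = q := by rcases honly p' hp1 with h | h; exact (hp' h).elim; exact h
    subst this
    intro v hv
    obtain ⟨w, hw, hw1⟩ := exists_end_of_pos hF hv
    rcases honly w hw1 with rfl | rfl
    · exact hw.symm
    · exact hpp'.trans hw.symm
  have hna : ¬ F.Adj p q := by
    intro hadj
    obtain ⟨z, hz⟩ := h2
    obtain ⟨w⟩ := hR z (by omega)
    have : ∀ a b : α, F.Walk a b → a = p ∨ a = q → b = p ∨ b = q := by
      intro a b w
      induction w with
      | nil => exact id
      | cons h w ih =>
        intro ha
        apply ih
        rcases ha with rfl | rfl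
        · exact Or.inr (eq_of_degS_le_one hp.le h hadj)
        · exact Or.inl (eq_of_degS_le_one hq.le h hadj.symm)
    rcases this _ _ w (Or.inl rfl) with rfl | rfl <;> omega
  refine ⟨hna, ?_, ?_, ?_⟩
  · intro h
    have : (F ⊔ edge p q).Adj p q := by
      rw [sup_adj, edge_adj]; exact Or.inr ⟨Or.inl ⟨rfl, rfl⟩, hpq⟩
    rw [h] at this
    exact this
  · intro v
    rw [degS_add_edge hpq hna]
    have := hF.2 v
    have := honly v
    split_ifs with h
    · rcases h with rfl | rfl <;> omega
    · have : degS F v ≠ 1 := fun h' => h (honly v h')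
      omega
  · have : ∀ v, 0 < degS (F ⊔ edge p q) v → (F ⊔ edge p q).Reachable p v := by
      intro v hv
      rw [degS_add_edge hpq hna] at hv
      split_ifs at hv with h
      · rcases h with rfl | rfl
        · exact .rfl
        · exact (hR v (by omega)).mono le_sup_left
      · exact (hR v (by omega)).mono le_sup_left
    intro u v hu hv
    exact (this u hu).symm.trans (this v hv)

end LinearForest

section Link

theorem linearForest_of_exists_end [Finite α] {F : SimpleGraph α} (h2 : ∀ v, degS F v ≤ 2)
    (h : ∀ v, ∃ w, F.Reachable v w ∧ degS F w ≤ 1) : IsLinearForest F := by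
  refine ⟨fun v c hc => ?_, h2⟩
  obtain ⟨w, hvw, hw⟩ := h v
  have hdeg : ∀ x ∈ c.support, c.toSubgraph.neighborSet x = F.neighborSet x ∧ degS F x = 2 := by
    intro x hx
    have h1 := hc.ncard_neighborSet_toSubgraph_eq_two hx
    have hsub : c.toSubgraph.neighborSet x ⊆ F.neighborSet x := c.toSubgraph.neighborSet_subset x
    have hle := Set.ncard_le_ncard hsub (Set.toFinite _)
    have h3 : (F.neighborSet x).ncard ≤ 2 := h2 x
    refine ⟨Set.eq_of_subset_of_ncard_le hsub (by omega) (Set.toFinite _), ?_⟩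
    unfold degS
    omega
  have hcl : ∀ a b : α, F.Walk a b → a ∈ c.support → b ∈ c.support := by
    intro a b p
    induction p with
    | nil => exact id
    | cons hadj p ih =>
      intro ha
      apply ih
      have := (Set.ext_iff.1 (hdeg _ ha).1 _).2 hadj
      rw [Subgraph.mem_neighborSet] at this
      exact (c.mem_verts_toSubgraph).1 this.snd_mem
  obtain ⟨p⟩ := hvw
  have := (hdeg w (hcl _ _ p c.start_mem_support)).2
  omega

theorem linearForest_sdiff [Finite α] {P M : SimpleGraph α} (hP : IsPolycycle P) (hM : M ≤ P)
    (hit : ∀ v, 0 < degS P v → ∃ w, P.Reachable v w ∧ 0 < degS M w) :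
    IsLinearForest (P \ M) := by
  have hsum := degS_sdiff_add hM
  apply linearForest_of_exists_end
  · intro v
    have := hsum v
    rcases hP v with h | h <;> omega
  · intro v
    by_cases hv : 0 < degS P v
    · obtain ⟨w, ⟨p⟩, hw⟩ := hit v hv
      have : ∃ w', (P \ M).Reachable v w' ∧ 0 < degS M w' := by
        clear hv
        induction p with
        | nil => exact ⟨_, .rfl, hw⟩
        | @cons a b c hadj p ih =>
          by_cases hMab : M.Adj a b
          · exact ⟨a, .rfl, degS_pos_of_adj hMab⟩
          · obtain ⟨w', h1, h2⟩ := ih hw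
            exact ⟨w', (Adj.reachable (G := P \ M) ⟨hadj, hMab⟩).trans h1, h2⟩
      obtain ⟨w', h1, h2⟩ := this
      refine ⟨w', h1, ?_⟩
      have := hsum w'
      rcases hP w' with h | h <;> omega
    · have := hsum v
      exact ⟨v, .rfl, by omega⟩

theorem sup_edge_eq_symmDiff {A : SimpleGraph α} {p q : α} (h : ¬ A.Adj p q) :
    A ⊔ edge p q = symmDiff A (edge p q) :=
  ((disjoint_edge h).symmDiff_eq_sup).symm

theorem symmDiff_sup_edge {A B : SimpleGraph α} {p q : α} (hA : ¬ A.Adj p q) (hB : ¬ B.Adj p q) :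
    symmDiff (A ⊔ edge p q) (B ⊔ edge p q) = symmDiff A B := by
  rw [sup_edge_eq_symmDiff hA, sup_edge_eq_symmDiff hB, symmDiff_symmDiff_symmDiff_comm,
    symmDiff_self, symmDiff_bot]

theorem ncard_ends_join_lt [Finite α] {A : SimpleGraph α} {p q : α} (hpq : p ≠ q)
    (hadj : ¬ A.Adj p q)
    (hp : degS A p = 1) (hq : degS A q = 1) :
    {v | degS (A ⊔ edge p q) v = 1}.ncard < {v | degS A v = 1}.ncard := by
  classical
  apply Set.ncard_lt_ncard _ (Set.toFinite _)
  rw [Set.ssubset_iff_of_subset]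
  · refine ⟨p, hp, ?_⟩
    simp [degS_add_edge hpq hadj, hp]
  · intro v hv
    simp only [Set.mem_ofPred_eq, degS_add_edge hpq hadj] at hv ⊢
    split_ifs at hv with h
    · rcases h with rfl | rfl <;> omega
    · exact hv

/-- Two linear forests with the same vertices of degree one can be completed to cycles by adding the
same edges to both. -/
theorem exists_two_cycles [Finite α] {A B : SimpleGraph α} (hA : IsLinearForest A)
    (hB : IsLinearForest B)
    (hAB : ∀ v, degS A v = 1 ↔ degS B v = 1) (h2A : ∃ z, degS A z = 2) (h2B : ∃ z, degS B z = 2) :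
    ∃ A' B', IsCycleGraph A' ∧ IsCycleGraph B' ∧ symmDiff A' B' = symmDiff A B := by
  classical
  induction hn : {v | degS A v = 1}.ncard using Nat.strong_induction_on generalizing A B with
  | _ n ih =>
  obtain ⟨z, hz⟩ := h2A
  obtain ⟨p, -, hp⟩ := exists_end_of_pos hA (v := z) (by omega)
  have hpB := (hAB p).1 hp
  by_cases hex : ∃ q, degS A q = 1 ∧ ¬ A.Reachable p q ∧ ¬ B.Reachable p q
  · obtain ⟨q, hq, hrA, hrB⟩ := hex
    have hqB := (hAB q).1 hq
    have hpq : p ≠ q := fun h => hrA (h ▸ .rfl)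
    have hadjA : ¬ A.Adj p q := fun h => hrA h.reachable
    have hadjB : ¬ B.Adj p q := fun h => hrB h.reachable
    obtain ⟨A', B', h1, h2, h3⟩ := ih _ (hn ▸ ncard_ends_join_lt hpq hadjA hp hq)
      (linearForest_join hA hp.le hq.le hrA) (linearForest_join hB hpB.le hqB.le hrB)
      (by
        intro v
        rw [degS_add_edge hpq hadjA, degS_add_edge hpq hadjB]
        have := hAB v
        split_ifs with h
        · rcases h with rfl | rfl <;> simp [*]
        · simpa using this)
      ⟨p, by rw [degS_add_edge hpq hadjA]; simp [hp]⟩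
      ⟨p, by rw [degS_add_edge hpq hadjB]; simp [hpB]⟩ rfl
    exact ⟨A', B', h1, h2, h3.trans (symmDiff_sup_edge hadjA hadjB)⟩
  · push Not at hex
    obtain ⟨q, hqp, hpq, hq⟩ := exists_partner hA hp
    obtain ⟨q', hq'p, hpq', hq'⟩ := exists_partner hB hpB
    have hqB := (hAB q).1 hq
    have hq'A := (hAB q').2 hq'
    have hqq : q' = q := by
      by_contra hne
      have hnA : ¬ A.Reachable p q' := fun h =>
        hne (eq_of_three_ends hA hp.le hq'A.le hq.le hq'p.symm hqp.symm h hpq)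
      obtain ⟨s, hsq', hq's, hs⟩ := exists_partner hA hq'A
      have hsB := (hAB s).1 hs
      have hnAs : ¬ A.Reachable p s := fun h => hnA (h.trans hq's.symm)
      have hps := hex s hs hnAs
      have hsp : s ≠ p := fun h => hnAs (h ▸ .rfl)
      exact hsq' (eq_of_three_ends hB hpB.le hsB.le hq'.le hsp.symm hq'p.symm hps hpq')
    subst hqq
    have honly : ∀ v, degS A v = 1 → v = p ∨ v = q' := by
      intro v hv
      by_contra! hne
      by_cases hr : A.Reachable p v
      · exact hne.2 (eq_of_three_ends hA hp.le hv.le hq'A.le hne.1.symm hqp.symm hr hpq)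
      · exact hne.2 (eq_of_three_ends hB hpB.le ((hAB v).1 hv).le hq'.le hne.1.symm hqp.symm
          (hex v hv hr) hpq')
    obtain ⟨hna, hcA⟩ := isCycleGraph_close hA hqp.symm hp hq'A honly ⟨z, hz⟩
    obtain ⟨hnb, hcB⟩ := isCycleGraph_close hB hqp.symm hpB hq'
      (fun v hv => honly v ((hAB v).2 hv)) h2B
    exact ⟨_, _, hcA, hcB, symmDiff_sup_edge hna hnb⟩

end Link

section Triple

/-- Three linear forests such that `A` and `C`, respectively `B` and `C`, can be linked along their
common vertices of degree one. -/
structure Linkable (A B C : SimpleGraph α) : Prop where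
  forest_left : IsLinearForest A
  forest_mid : IsLinearForest B
  forest_right : IsLinearForest C
  parity : ∀ v, Even (degS A v + degS B v + degS C v)
  reach_left : ∀ r s, degS A r = 1 → degS C r = 1 → degS A s = 1 → degS C s = 1 →
    A.Reachable r s → C.Reachable r s
  reach_mid : ∀ r s, degS B r = 1 → degS C r = 1 → degS B s = 1 → degS C s = 1 →
    B.Reachable r s → C.Reachable r s

variable {A B C : SimpleGraph α}

theorem Linkable.swap (h : Linkable A B C) : Linkable B A C :=
  ⟨h.forest_mid, h.forest_left, h.forest_right,
    fun v => by rw [add_comm (degS B v)]; exact h.parity v,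
    h.reach_mid, h.reach_left⟩

theorem Linkable.eq_one_or (h : Linkable A B C) {v : α} (hv : degS C v = 1) :
    (degS A v = 1 ∧ degS B v ≠ 1) ∨ (degS B v = 1 ∧ degS A v ≠ 1) := by
  have h1 := h.parity v
  have h2 := h.forest_left.2 v
  have h3 := h.forest_mid.2 v
  rw [hv] at h1
  grind

theorem Linkable.join [Finite α] (h : Linkable A B C) {r s : α} (hrA : degS A r = 1)
    (hrC : degS C r = 1)
    (hsA : degS A s = 1) (hsC : degS C s = 1) (hrs : ¬ C.Reachable r s) :
    Linkable (A ⊔ edge r s) B (C ⊔ edge r s) := by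
  classical
  have hrsA : ¬ A.Reachable r s := fun h' => hrs (h.reach_left r s hrA hrC hsA hsC h')
  have hne : r ≠ s := fun h' => hrs (h' ▸ .rfl)
  have haA : ¬ A.Adj r s := fun h' => hrsA h'.reachable
  have haC : ¬ C.Adj r s := fun h' => hrs h'.reachable
  have key : ∀ v, degS (C ⊔ edge r s) v = 1 → degS C v = 1 ∧ v ≠ r ∧ v ≠ s := by
    intro v hv
    rw [degS_add_edge hne haC] at hv
    grind
  refine ⟨linearForest_join h.forest_left hrA.le hsA.le hrsA, h.forest_mid,
    linearForest_join h.forest_right hrC.le hsC.le hrs, ?_, ?_, ?_⟩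
  · intro v
    rw [degS_add_edge hne haA, degS_add_edge hne haC]
    have := h.parity v
    split_ifs <;> grind
  · intro x y hxA hxC hyA hyC hr
    obtain ⟨hxC, hxr, hxs⟩ := key x hxC
    obtain ⟨hyC, hyr, hys⟩ := key y hyC
    rw [degS_add_edge hne haA, if_neg (by tauto)] at hxA hyA
    rw [reachable_add_edge hne] at hr ⊢
    rcases hr with hr | ⟨h1, h2⟩ | ⟨h1, h2⟩
    · exact Or.inl (h.reach_left x y hxA hxC hyA hyC hr)
    · exact Or.inr (Or.inl
        ⟨h.reach_left x r hxA hxC hrA hrC h1, h.reach_left s y hsA hsC hyA hyC h2⟩)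
    · exact Or.inr (Or.inr
        ⟨h.reach_left x s hxA hxC hsA hsC h1, h.reach_left r y hrA hrC hyA hyC h2⟩)
  · intro x y hxB hxC hyB hyC hr
    exact (h.reach_mid x y hxB (key x hxC).1 hyB (key y hyC).1 hr).mono le_sup_left

theorem exists_three_cycles [Finite α] (h : Linkable A B C)
    (heven : Even {v | degS A v = 1 ∧ degS C v = 1}.ncard)
    (hmix : ∃ r t, degS A r = 1 ∧ degS C r = 1 ∧ degS B t = 1 ∧ degS C t = 1 ∧ C.Reachable r t)
    (h2A : ∃ z, degS A z = 2) (h2B : ∃ z, degS B z = 2) :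
    ∃ A' B' C', IsCycleGraph A' ∧ IsCycleGraph B' ∧ IsCycleGraph C' ∧
      symmDiff (symmDiff A' B') C' = symmDiff (symmDiff A B) C := by
  classical
  induction hn : {v | degS C v = 1}.ncard using Nat.strong_induction_on generalizing A B C with
  | _ n ih =>
  obtain ⟨r₀, t₀, hr₀, hr₀C, ht₀, ht₀C, hrt₀⟩ := hmix
  have hC := h.forest_right
  have hAB : ∀ {v w}, degS A v = 1 → degS B w = 1 → degS C v = 1 → v ≠ w := by
    rintro v w hv hw hvC rfl
    rcases h.eq_one_or hvC with h' | h' <;> tauto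
  have hr₀t₀ : r₀ ≠ t₀ := hAB hr₀ ht₀ hr₀C
  have hnr : ∀ {v}, degS C v = 1 → v ≠ r₀ → v ≠ t₀ → ¬ C.Reachable r₀ v := fun hv h1 h2 hr =>
    h2 (eq_of_three_ends hC hr₀C.le hv.le ht₀C.le h1.symm hr₀t₀ hr hrt₀)
  -- one linking step along `A` and `C`
  have step : ∀ s r t, degS A s = 1 → degS C s = 1 → s ≠ r₀ → degS A r = 1 → degS C r = 1 →
      r ≠ r₀ → r ≠ s → degS B t = 1 → degS C t = 1 → (C ⊔ edge r₀ s).Reachable r t →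
      ∃ A' B' C', IsCycleGraph A' ∧ IsCycleGraph B' ∧ IsCycleGraph C' ∧
        symmDiff (symmDiff A' B') C' = symmDiff (symmDiff A B) C := by
    intro s r t hs hsC hsr₀ hr hrC hrr₀ hrs ht htC hrt
    have hns : ¬ C.Reachable r₀ s := hnr hsC hsr₀ (hAB hs ht₀ hsC)
    have hnsA : ¬ A.Reachable r₀ s := fun h' => hns (h.reach_left _ _ hr₀ hr₀C hs hsC h')
    have haC : ¬ C.Adj r₀ s := fun h' => hns h'.reachable
    have haA : ¬ A.Adj r₀ s := fun h' => hnsA h'.reachable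
    have htr₀ : t ≠ r₀ := (hAB hr₀ ht hr₀C).symm
    have hts : t ≠ s := (hAB hs ht hsC).symm
    have hset : {v | degS A v = 1 ∧ degS C v = 1} =
        insert r₀ (insert s {v | degS (A ⊔ edge r₀ s) v = 1 ∧ degS (C ⊔ edge r₀ s) v = 1}) := by
      ext v
      simp only [Set.mem_ofPred_eq, Set.mem_insert_iff, degS_add_edge hsr₀.symm haA,
        degS_add_edge hsr₀.symm haC]
      grind
    rw [hset, Set.ncard_insert_of_notMem _ (Set.toFinite _),
      Set.ncard_insert_of_notMem _ (Set.toFinite _)] at heven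
    · obtain ⟨A', B', C', h1, h2, h3, h4⟩ := ih _
        (hn ▸ ncard_ends_join_lt hsr₀.symm haC hr₀C hsC) (h.join hr₀ hr₀C hs hsC hns)
        (by grind)
        ⟨r, t, by rw [degS_add_edge hsr₀.symm haA]; grind,
          by rw [degS_add_edge hsr₀.symm haC]; grind,
          ht, by rw [degS_add_edge hsr₀.symm haC]; grind, hrt⟩
        ⟨r₀, by rw [degS_add_edge hsr₀.symm haA]; grind⟩ h2B rfl
      refine ⟨A', B', C', h1, h2, h3, h4.trans ?_⟩
      rw [symmDiff_right_comm, symmDiff_sup_edge haA haC, symmDiff_right_comm]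
    · simp only [Set.mem_ofPred_eq, degS_add_edge hsr₀.symm haA]
      grind
    · simp only [Set.mem_insert_iff, Set.mem_ofPred_eq, degS_add_edge hsr₀.symm haA]
      grind
  -- one linking step along `B` and `C`
  have step' : ∀ s t, degS B s = 1 → degS C s = 1 → s ≠ t₀ → degS B t = 1 → degS C t = 1 →
      t ≠ t₀ → t ≠ s → C.Reachable s t →
      ∃ A' B' C', IsCycleGraph A' ∧ IsCycleGraph B' ∧ IsCycleGraph C' ∧
        symmDiff (symmDiff A' B') C' = symmDiff (symmDiff A B) C := by
    intro s t hs hsC hst₀ ht htC htt₀ hts hst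
    have hns : ¬ C.Reachable t₀ s := fun h' =>
      hnr hsC (hAB hr₀ hs hr₀C).symm hst₀ (hrt₀.trans h')
    have hnsB : ¬ B.Reachable t₀ s := fun h' => hns (h.reach_mid _ _ ht₀ ht₀C hs hsC h')
    have haC : ¬ C.Adj t₀ s := fun h' => hns h'.reachable
    have haB : ¬ B.Adj t₀ s := fun h' => hnsB h'.reachable
    have hset : {v | degS A v = 1 ∧ degS C v = 1} =
        {v | degS A v = 1 ∧ degS (C ⊔ edge t₀ s) v = 1} := by
      ext v
      simp only [Set.mem_ofPred_eq, degS_add_edge hst₀.symm haC]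
      have := @hAB v t₀
      have := @hAB v s
      grind
    obtain ⟨A', B', C', h1, h2, h3, h4⟩ := ih _
      (hn ▸ ncard_ends_join_lt hst₀.symm haC ht₀C hsC) (h.swap.join ht₀ ht₀C hs hsC hns).swap
      (by rwa [← hset])
      ⟨r₀, t, hr₀, by rw [degS_add_edge hst₀.symm haC]; have := @hAB r₀ s; grind,
        by rw [degS_add_edge hst₀.symm haB]; grind, by rw [degS_add_edge hst₀.symm haC]; grind,
        by rw [reachable_add_edge hst₀.symm]; exact Or.inr (Or.inl ⟨hrt₀, hst⟩)⟩
      h2A ⟨t₀, by rw [degS_add_edge hst₀.symm haB]; grind⟩ rfl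
    refine ⟨A', B', C', h1, h2, h3, h4.trans ?_⟩
    rw [symmDiff_assoc, symmDiff_sup_edge haB haC, ← symmDiff_assoc]
  obtain ⟨r₁, hr₁, hr₁C, hr₁r₀⟩ : ∃ r, degS A r = 1 ∧ degS C r = 1 ∧ r ≠ r₀ := by
    by_contra! hno
    have : {v | degS A v = 1 ∧ degS C v = 1} = {r₀} := by
      ext v
      simp only [Set.mem_ofPred_eq, Set.mem_singleton_iff]
      exact ⟨fun hv => hno v hv.1 hv.2, fun hv => hv ▸ ⟨hr₀, hr₀C⟩⟩
    rw [this, Set.ncard_singleton] at heven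
    exact absurd heven (by decide)
  have hnr₁ : ¬ C.Reachable r₀ r₁ := hnr hr₁C hr₁r₀ (hAB hr₁ ht₀ hr₁C)
  by_cases hthird : ∃ r, degS A r = 1 ∧ degS C r = 1 ∧ r ≠ r₀ ∧ r ≠ r₁
  · obtain ⟨r₂, hr₂, hr₂C, hr₂r₀, hr₂r₁⟩ := hthird
    obtain ⟨p, hp, hr₂p, hpC⟩ := exists_partner hC hr₂C
    have hnr₂ : ¬ C.Reachable r₀ r₂ := hnr hr₂C hr₂r₀ (hAB hr₂ ht₀ hr₂C)
    rcases h.eq_one_or hpC with hp1 | hp1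
    · refine step r₂ p t₀ hr₂ hr₂C hr₂r₀ hp1.1 hpC ?_ hp ht₀ ht₀C ?_
      · rintro rfl
        exact hnr₂ hr₂p.symm
      · rw [reachable_add_edge hr₂r₀.symm]
        exact Or.inr (Or.inr ⟨hr₂p.symm, hrt₀⟩)
    · exact step r₁ r₂ p hr₁ hr₁C hr₁r₀ hr₂ hr₂C hr₂r₀ hr₂r₁ hp1.1 hpC (hr₂p.mono le_sup_left)
  push Not at hthird
  obtain ⟨s₁, hs₁r₁, hrs₁, hs₁C⟩ := exists_partner hC hr₁C
  have hs₁r₀ : s₁ ≠ r₀ := by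
    rintro rfl
    exact hnr₁ hrs₁.symm
  have hs₁ : degS B s₁ = 1 := by
    rcases h.eq_one_or hs₁C with h' | h'
    · exact (hs₁r₁ (hthird s₁ h'.1 hs₁C hs₁r₀)).elim
    · exact h'.1
  have hs₁t₀ : s₁ ≠ t₀ := by
    rintro rfl
    exact hnr₁ (hrt₀.trans hrs₁.symm)
  by_cases hmore : ∃ t, degS B t = 1 ∧ degS C t = 1 ∧ t ≠ t₀ ∧ t ≠ s₁
  · obtain ⟨t₂, ht₂, ht₂C, ht₂t₀, ht₂s₁⟩ := hmore
    have hnt₂ : ¬ C.Reachable r₀ t₂ := hnr ht₂C (hAB hr₀ ht₂ hr₀C).symm ht₂t₀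
    obtain ⟨p, hp, ht₂p, hpC⟩ := exists_partner hC ht₂C
    have hpr₀ : p ≠ r₀ := by rintro rfl; exact hnt₂ ht₂p.symm
    have hpt₀ : p ≠ t₀ := by rintro rfl; exact hnt₂ (hrt₀.trans ht₂p.symm)
    have hpr₁ : p ≠ r₁ := by
      rintro rfl
      exact ht₂s₁ (eq_of_three_ends hC hpC.le ht₂C.le hs₁C.le hp hs₁r₁.symm ht₂p.symm hrs₁)
    have hpB : degS B p = 1 := by
      rcases h.eq_one_or hpC with h' | h'
      · exact (hpr₁ (hthird p h'.1 hpC hpr₀)).elim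
      · exact h'.1
    exact step' t₂ p ht₂ ht₂C ht₂t₀ hpB hpC hpt₀ hp ht₂p
  push Not at hmore
  have haC : ¬ C.Adj r₀ r₁ := fun h' => hnr₁ h'.reachable
  have haA : ¬ A.Adj r₀ r₁ := fun h' => hnr₁ (h.reach_left _ _ hr₀ hr₀C hr₁ hr₁C h'.reachable)
  have hnts : ¬ C.Reachable t₀ s₁ := fun h' => hnr hs₁C hs₁r₀ hs₁t₀ (hrt₀.trans h')
  have hntsB : ¬ B.Reachable t₀ s₁ := fun h' => hnts (h.reach_mid _ _ ht₀ ht₀C hs₁ hs₁C h')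
  have haB : ¬ B.Adj t₀ s₁ := fun h' => hntsB h'.reachable
  have h1 := h.join hr₀ hr₀C hr₁ hr₁C hnr₁
  have hr₁t₀ : r₁ ≠ t₀ := hAB hr₁ ht₀ hr₁C
  have dC : ∀ v, degS (C ⊔ edge r₀ r₁) v = 1 → v = t₀ ∨ v = s₁ := by
    intro v hv
    rw [degS_add_edge hr₁r₀.symm haC] at hv
    by_cases hv1 : v = r₀ ∨ v = r₁
    · rw [if_pos hv1] at hv
      rcases hv1 with rfl | rfl <;> omega
    · rw [if_neg hv1] at hv
      push Not at hv1
      rcases h.eq_one_or hv with h' | h'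
      · exact (hv1.2 (hthird v h'.1 hv hv1.1)).elim
      · by_cases hvt : v = t₀
        · exact Or.inl hvt
        · exact Or.inr (hmore v h'.1 hv hvt)
  obtain ⟨hna, hcyc⟩ := isCycleGraph_close h1.forest_right hs₁t₀.symm
    (by rw [degS_add_edge hr₁r₀.symm haC]; grind) (by rw [degS_add_edge hr₁r₀.symm haC]; grind) dC
    ⟨r₀, by rw [degS_add_edge hr₁r₀.symm haC]; grind⟩
  obtain ⟨A', B', hA', hB', hsd⟩ := exists_two_cycles h1.forest_left
    (linearForest_join h.forest_mid ht₀.le hs₁.le hntsB)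
    (by
      intro v
      have p1 := h1.parity v
      have p2 : degS (A ⊔ edge r₀ r₁) v ≤ 2 := h1.forest_left.2 v
      have p3 := (linearForest_join h.forest_mid ht₀.le hs₁.le hntsB).2 v
      have p4 := hcyc.2.1 v
      rw [degS_add_edge hs₁t₀.symm haB] at p3 ⊢
      rw [degS_add_edge hs₁t₀.symm hna] at p4
      split_ifs at p3 p4 ⊢ <;> grind)
    ⟨r₀, by rw [degS_add_edge hr₁r₀.symm haA]; grind⟩
    ⟨t₀, by rw [degS_add_edge hs₁t₀.symm haB]; grind⟩
  refine ⟨A', B', _, hA', hB', hcyc, ?_⟩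
  rw [hsd, symmDiff_assoc, symmDiff_sup_edge haB hna, ← symmDiff_assoc, symmDiff_right_comm,
    symmDiff_sup_edge haA haC, symmDiff_right_comm]

end Triple

section Transversal

/-- `M` consists of at most one edge from each component of `P`, and its union with `N` is a linear
forest. -/
structure PartialTransversal (P M N : SimpleGraph α) : Prop where
  le : M ≤ P
  deg_le : ∀ v, degS M v ≤ 1
  reach : ∀ r s, 0 < degS M r → 0 < degS M s → P.Reachable r s → M.Reachable r s
  forest : IsLinearForest (M ⊔ N)

variable {P M N : SimpleGraph α}

theorem eq_or_eq_of_adj_ends [Finite α] {F : SimpleGraph α} {p q v : α} (hadj : F.Adj p q)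
    (hp : degS F p ≤ 1) (hq : degS F q ≤ 1) (hr : F.Reachable p v) : v = p ∨ v = q := by
  obtain ⟨w⟩ := hr
  have : ∀ a b : α, F.Walk a b → a = p ∨ a = q → b = p ∨ b = q := by
    intro a b w
    induction w with
    | nil => exact id
    | cons h w ih =>
      intro ha
      apply ih
      rcases ha with rfl | rfl
      · exact Or.inr (eq_of_degS_le_one hp h hadj)
      · exact Or.inl (eq_of_degS_le_one hq h hadj.symm)
  exact this _ _ w (Or.inl rfl)

theorem eq_or_adj_of_reachable [Finite α] {F : SimpleGraph α} (hF : ∀ v, degS F v ≤ 1) {p v : α}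
    (hr : F.Reachable p v) : v = p ∨ F.Adj p v := by
  by_cases hp : degS F p = 0
  · exact Or.inl (eq_of_reachable_of_degS_eq_zero hp hr).symm
  · obtain ⟨q, hq⟩ := degS_pos.1 (Nat.pos_of_ne_zero hp)
    rcases eq_or_eq_of_adj_ends hq (hF p) (hF q) hr with h | rfl
    · exact Or.inl h
    · exact Or.inr hq

theorem exists_adj_of_isPolycycle (hP : IsPolycycle P) {v : α} (hv : 0 < degS P v) (a : α) :
    ∃ b, b ≠ a ∧ P.Adj v b := by
  obtain ⟨x, y, hxy, h⟩ := degS_eq_two.1 ((hP v).resolve_left hv.ne')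
  by_cases hx : x = a
  · exact ⟨y, by rintro rfl; exact hxy hx, (h y).2 (Or.inr rfl)⟩
  · exact ⟨x, hx, (h x).2 (Or.inl rfl)⟩

theorem partialTransversal_bot (hN : IsLinearForest N) : PartialTransversal P ⊥ N :=
  ⟨bot_le, fun v => by simp [degS_bot], fun r _ hr => by simp [degS_bot] at hr, by simpa using hN⟩

theorem PartialTransversal.add_edge [Finite α] (h : PartialTransversal P M N)
    (hN : ∀ v, degS N v ≤ 1)
    (hPN : Disjoint P N) {y z : α} (hyz : P.Adj y z)
    (hy : ∀ w, P.Reachable y w → degS M w = 0) (hr : ¬ (M ⊔ N).Reachable y z) :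
    PartialTransversal P (M ⊔ edge y z) N := by
  classical
  have hna : ¬ M.Adj y z := fun h' => hr ((Adj.reachable h').mono le_sup_left)
  have hdy := hy y .rfl
  have hdz := hy z hyz.reachable
  have hdisj : Disjoint M N := hPN.mono_left h.le
  have hadj : (M ⊔ edge y z).Adj y z := by
    rw [sup_adj, edge_adj]; exact Or.inr ⟨Or.inl ⟨rfl, rfl⟩, hyz.ne⟩
  refine ⟨sup_le h.le (by rw [edge_le_iff]; exact Or.inr hyz), ?_, ?_, ?_⟩
  · intro v
    rw [degS_add_edge hyz.ne hna]
    have := h.deg_le v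
    split_ifs with hv
    · rcases hv with rfl | rfl <;> omega
    · simpa using this
  · have key : ∀ r s, (r = y ∨ r = z) → 0 < degS (M ⊔ edge y z) s → P.Reachable r s →
        (M ⊔ edge y z).Reachable r s := by
      intro r s hry hs hrs
      have hys : P.Reachable y s := by
        rcases hry with rfl | rfl
        · exact hrs
        · exact hyz.reachable.trans hrs
      rw [degS_add_edge hyz.ne hna, hy s hys] at hs
      have hs' : s = y ∨ s = z := by
        by_contra h'
        rw [if_neg h'] at hs
        omega
      rcases hry with rfl | rfl <;> rcases hs' with rfl | rfl
      · exact .rfl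
      · exact hadj.reachable
      · exact hadj.symm.reachable
      · exact .rfl
    intro r s hr hs hrs
    by_cases hry : r = y ∨ r = z
    · exact key r s hry hs hrs
    by_cases hsy : s = y ∨ s = z
    · exact (key s r hsy hr hrs.symm).symm
    rw [degS_add_edge hyz.ne hna, if_neg hry] at hr
    rw [degS_add_edge hyz.ne hna, if_neg hsy] at hs
    exact (h.reach r s hr hs hrs).mono le_sup_left
  · rw [sup_right_comm]
    apply linearForest_join h.forest _ _ hr
    · rw [degS_sup hdisj, hdy]; simpa using hN y
    · rw [degS_sup hdisj, hdz]; simpa using hN z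

theorem PartialTransversal.exists_adj [Finite α] (h : PartialTransversal P M N) (hP : IsPolycycle P)
    (hN : ∀ v, degS N v ≤ 1) (hPN : Disjoint P N) {y : α} (hy0 : 0 < degS P y)
    (hy : ∀ w, P.Reachable y w → degS M w = 0) :
    ∃ z, P.Adj y z ∧ ¬ (M ⊔ N).Reachable y z := by
  have hdisj : Disjoint M N := hPN.mono_left h.le
  have hd : ∀ w, P.Reachable y w → degS (M ⊔ N) w ≤ 1 := by
    intro w hw
    rw [degS_sup hdisj, hy w hw]
    simpa using hN w
  obtain ⟨a, -, ha⟩ := exists_adj_of_isPolycycle hP hy0 y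
  obtain ⟨b, hba, hb⟩ := exists_adj_of_isPolycycle hP hy0 a
  by_cases hra : (M ⊔ N).Reachable y a
  · refine ⟨b, hb, fun hrb => hba ?_⟩
    exact eq_of_three_ends h.forest (hd y .rfl) (hd b hb.reachable) (hd a ha.reachable) hb.ne ha.ne
      hrb hra
  · exact ⟨a, ha, hra⟩

theorem PartialTransversal.exists_hitting [Finite α] (h : PartialTransversal P M N)
    (hP : IsPolycycle P)
    (hN : ∀ v, degS N v ≤ 1) (hPN : Disjoint P N) :
    ∃ M', PartialTransversal P M' N ∧ M ≤ M' ∧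
      (∀ v, 0 < degS P v → ∃ w, P.Reachable v w ∧ 0 < degS M' w) ∧
      ∀ v, 0 < degS M' v → 0 < degS M v ∨ ∀ w, P.Reachable v w → degS M w = 0 := by
  classical
  induction M using WellFoundedGT.induction with
  | ind M ih =>
    by_cases hit : ∀ v, 0 < degS P v → ∃ w, P.Reachable v w ∧ 0 < degS M w
    · exact ⟨M, h, le_rfl, hit, fun v hv => Or.inl hv⟩
    push Not at hit
    obtain ⟨y, hy0, hy⟩ := hit
    replace hy : ∀ w, P.Reachable y w → degS M w = 0 := fun w hw => Nat.le_zero.1 (hy w hw)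
    obtain ⟨z, hyz, hr⟩ := h.exists_adj hP hN hPN hy0 hy
    have hna : ¬ M.Adj y z := fun h' => hr ((Adj.reachable h').mono le_sup_left)
    have hlt : M < M ⊔ edge y z := by
      rw [left_lt_sup, edge_le_iff]
      simp [hna, hyz.ne]
    obtain ⟨M', h1, h2, h3, h4⟩ := ih _ hlt (h.add_edge hN hPN hyz hy hr)
    refine ⟨M', h1, hlt.le.trans h2, h3, fun v hv => ?_⟩
    rcases h4 v hv with h' | h'
    · rw [degS_add_edge hyz.ne hna] at h'
      split_ifs at h' with hvy
      · right
        rcases hvy with rfl | rfl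
        · exact hy
        · exact fun w hw => hy w (hyz.reachable.trans hw)
      · exact Or.inl h'
    · exact Or.inr fun w hw => Nat.le_zero.1 ((degS_mono le_sup_left w).trans (h' w hw).le)

theorem listSymmDiff_append (L L' : List (SimpleGraph α)) :
    listSymmDiff (L ++ L') = symmDiff (listSymmDiff L) (listSymmDiff L') := by
  induction L with
  | nil => simp [listSymmDiff]
  | cons a L ih =>
    simp only [listSymmDiff, List.cons_append, List.foldr_cons] at ih ⊢
    rw [ih, symmDiff_assoc]

theorem isLinearForest_bot : IsLinearForest (⊥ : SimpleGraph α) :=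
  ⟨isAcyclic_bot, fun v => by simp [degS_bot]⟩

/-- A polycycle is the symmetric difference of at most two cycles. -/
theorem exists_two_cycles_of_isPolycycle [Finite α] (hP : IsPolycycle P) :
    ∃ L : List (SimpleGraph α), L.length ≤ 2 ∧ (∀ C ∈ L, IsCycleGraph C) ∧ listSymmDiff L = P := by
  classical
  by_cases hne : P = ⊥
  · exact ⟨[], by simp, by simp, by simp [listSymmDiff, hne]⟩
  by_cases hconn : ∀ u v, 0 < degS P u → 0 < degS P v → P.Reachable u v
  · exact ⟨[P], by simp, by simpa using ⟨hne, hP, hconn⟩, by simp [listSymmDiff]⟩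
  push Not at hconn
  obtain ⟨p, q, hp, hq, hpq⟩ := hconn
  have hb : ∀ v, degS (⊥ : SimpleGraph α) v ≤ 1 := fun v => by simp [degS_bot]
  have h0 : PartialTransversal P ⊥ ⊥ := partialTransversal_bot isLinearForest_bot
  obtain ⟨p', hpp', hr⟩ := h0.exists_adj hP hb disjoint_bot_right hp fun w _ => degS_bot w
  have h1 := h0.add_edge hb disjoint_bot_right hpp' (fun w _ => degS_bot w) hr
  rw [bot_sup_eq] at h1
  have hq1 : ∀ w, P.Reachable q w → degS (edge p p') w = 0 := by
    intro w hw
    rw [degS_edge hpp'.ne, if_neg]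
    rintro (rfl | rfl)
    · exact hpq hw.symm
    · exact hpq (hpp'.reachable.trans hw.symm)
  obtain ⟨q', hqq', hr'⟩ := h1.exists_adj hP hb disjoint_bot_right hq hq1
  have h2 := h1.add_edge hb disjoint_bot_right hqq' hq1 hr'
  obtain ⟨M, hM, hle, hit, -⟩ := h2.exists_hitting hP hb disjoint_bot_right
  have hMp : degS M p = 1 := le_antisymm (hM.deg_le p)
    (degS_pos_of_adj (w := p')
      (hle (Or.inl (by rw [edge_adj]; exact ⟨Or.inl ⟨rfl, rfl⟩, hpp'.ne⟩))))
  have hMq : degS M q = 1 := le_antisymm (hM.deg_le q)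
    (degS_pos_of_adj (w := q')
      (hle (Or.inr (by rw [edge_adj]; exact ⟨Or.inl ⟨rfl, rfl⟩, hqq'.ne⟩))))
  have hsum := degS_sdiff_add hM.le
  have hdeg : ∀ v, degS (P \ M) v = 1 ↔ degS M v = 1 := by
    intro v
    have := hsum v
    have := hM.deg_le v
    rcases hP v with h | h <;> omega
  have hne' : p ≠ q := fun h => hpq (h ▸ .rfl)
  have hrA : ¬ (P \ M).Reachable p q := fun h => hpq (h.mono sdiff_le)
  have hrM : ¬ M.Reachable p q := fun h => hpq (h.mono hM.le)
  have haA : ¬ (P \ M).Adj p q := fun h => hrA h.reachable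
  have haM : ¬ M.Adj p q := fun h => hrM h.reachable
  have hAp := (hdeg p).2 hMp
  have hAq := (hdeg q).2 hMq
  have hMf : IsLinearForest M := by simpa using hM.forest
  obtain ⟨A', B', hA', hB', hsd⟩ := exists_two_cycles
    (linearForest_join (linearForest_sdiff hP hM.le hit) hAp.le hAq.le hrA)
    (linearForest_join hMf hMp.le hMq.le hrM)
    (by
      intro v
      rw [degS_add_edge hne' haA, degS_add_edge hne' haM]
      have := hdeg v
      split_ifs with h
      · rcases h with rfl | rfl <;> omega
      · simpa using this)
    ⟨p, by rw [degS_add_edge hne' haA]; simp [hAp]⟩ ⟨p, by rw [degS_add_edge hne' haM]; simp [hMp]⟩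
  refine ⟨[A', B'], by simp, by simp [hA', hB'], ?_⟩
  rw [symmDiff_sup_edge haA haM, disjoint_sdiff_self_left.symmDiff_eq_sup,
    sdiff_sup_cancel hM.le] at hsd
  simpa [listSymmDiff] using hsd

end Transversal

section Splitting

/-- Subgraphs `M₁`, `M₂` of two edge-disjoint polycycles such that the three linear forests
`P₁ \ M₁`, `P₂ \ M₂` and `M₁ ⊔ M₂` can be linked to cycles. -/
structure Splitting (P₁ P₂ M₁ M₂ : SimpleGraph α) : Prop where
  le₁ : M₁ ≤ P₁
  le₂ : M₂ ≤ P₂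
  hit₁ : ∀ v, 0 < degS P₁ v → ∃ w, P₁.Reachable v w ∧ 0 < degS M₁ w
  hit₂ : ∀ v, 0 < degS P₂ v → ∃ w, P₂.Reachable v w ∧ 0 < degS M₂ w
  reach₁ : ∀ r s, 0 < degS M₁ r → 0 < degS M₁ s → P₁.Reachable r s → M₁.Reachable r s
  reach₂ : ∀ r s, 0 < degS M₂ r → 0 < degS M₂ s → P₂.Reachable r s → M₂.Reachable r s
  forest : IsLinearForest (M₁ ⊔ M₂)
  even : Even {v | degS M₁ v = 1 ∧ degS M₂ v = 0}.ncard
  mixed : ∃ r t, degS M₁ r = 1 ∧ degS M₂ r = 0 ∧ degS M₁ t = 0 ∧ degS M₂ t = 1 ∧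
    (M₁ ⊔ M₂).Reachable r t
  free₁ : ∃ z, degS P₁ z = 2 ∧ degS M₁ z = 0
  free₂ : ∃ z, degS P₂ z = 2 ∧ degS M₂ z = 0

variable {P₁ P₂ M₁ M₂ : SimpleGraph α}

theorem even_ncard_ends [Finite α] {F : SimpleGraph α} (hF : IsLinearForest F) :
    Even {v | degS F v = 1}.ncard := by
  classical
  have := Fintype.ofFinite α
  have h := F.even_card_odd_degree_vertices
  have hd : ∀ v, F.degree v = degS F v := by
    intro v
    unfold degS
    rw [← Nat.card_coe_set_eq, Nat.card_eq_fintype_card, card_neighborSet_eq_degree]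
  rw [Set.ncard_eq_toFinset_card']
  convert h using 2
  ext v
  have := hF.2 v
  simp only [Set.mem_toFinset, Set.mem_ofPred_eq, Finset.mem_filter, Finset.mem_univ, true_and, hd]
  grind

theorem even_ncard_iff [Finite α] (hd : Disjoint M₁ M₂) (hF : IsLinearForest (M₁ ⊔ M₂)) :
    Even {v | degS M₁ v = 1 ∧ degS M₂ v = 0}.ncard ↔
      Even {v | degS M₂ v = 1 ∧ degS M₁ v = 0}.ncard := by
  have h := even_ncard_ends hF
  have hset : {v | degS (M₁ ⊔ M₂) v = 1} =
      {v | degS M₁ v = 1 ∧ degS M₂ v = 0} ∪ {v | degS M₂ v = 1 ∧ degS M₁ v = 0} := by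
    ext v
    simp only [Set.mem_ofPred_eq, Set.mem_union, degS_sup hd]
    omega
  rw [hset, Set.ncard_union_eq _ (Set.toFinite _) (Set.toFinite _), Nat.even_add] at h
  · exact h
  · rw [Set.disjoint_left]
    rintro v ⟨h1, h2⟩ ⟨h3, h4⟩
    omega

theorem Splitting.swap [Finite α] (h : Splitting P₁ P₂ M₁ M₂) (hd : Disjoint P₁ P₂) :
    Splitting P₂ P₁ M₂ M₁ := by
  obtain ⟨r, t, h1, h2, h3, h4, h5⟩ := h.mixed
  refine ⟨h.le₂, h.le₁, h.hit₂, h.hit₁, h.reach₂, h.reach₁, sup_comm M₁ M₂ ▸ h.forest,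
    (even_ncard_iff (hd.mono h.le₁ h.le₂) h.forest).1 h.even,
    ⟨t, r, h4, h3, h2, h1, sup_comm M₁ M₂ ▸ h5.symm⟩, h.free₂, h.free₁⟩

theorem Splitting.exists_three_cycles [Finite α] (h : Splitting P₁ P₂ M₁ M₂) (hP₁ : IsPolycycle P₁)
    (hP₂ : IsPolycycle P₂) (hd : Disjoint P₁ P₂) :
    ∃ L : List (SimpleGraph α), L.length ≤ 3 ∧ (∀ C ∈ L, IsCycleGraph C) ∧
      listSymmDiff L = P₁ ⊔ P₂ := by
  have hdM := hd.mono h.le₁ h.le₂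
  have s1 := degS_sdiff_add h.le₁
  have s2 := degS_sdiff_add h.le₂
  have s3 := degS_sup hdM
  have e1 : ∀ v, degS (P₁ \ M₁) v = 1 ↔ degS M₁ v = 1 := by
    intro v; have := s1 v; rcases hP₁ v with h' | h' <;> omega
  have e2 : ∀ v, degS (P₂ \ M₂) v = 1 ↔ degS M₂ v = 1 := by
    intro v; have := s2 v; rcases hP₂ v with h' | h' <;> omega
  have hlink : Linkable (P₁ \ M₁) (P₂ \ M₂) (M₁ ⊔ M₂) := by
    refine ⟨linearForest_sdiff hP₁ h.le₁ h.hit₁, linearForest_sdiff hP₂ h.le₂ h.hit₂, h.forest,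
      ?_, ?_, ?_⟩
    · intro v
      have := s1 v
      have := s2 v
      rw [s3 v]
      rcases hP₁ v with h' | h' <;> rcases hP₂ v with hlast | hlast <;> grind
    · intro r s hr _ hs _ hrs
      rw [e1] at hr hs
      exact (h.reach₁ r s (by omega) (by omega) (hrs.mono sdiff_le)).mono le_sup_left
    · intro r s hr _ hs _ hrs
      rw [e2] at hr hs
      exact (h.reach₂ r s (by omega) (by omega) (hrs.mono sdiff_le)).mono le_sup_right
  obtain ⟨r, t, h1, h2, h3, h4, h5⟩ := h.mixed
  obtain ⟨z₁, hz₁, hz₁'⟩ := h.free₁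
  obtain ⟨z₂, hz₂, hz₂'⟩ := h.free₂
  obtain ⟨A', B', C', hA, hB, hC, hsd⟩ := CycleOddCover.exists_three_cycles hlink
    (by
      convert h.even using 3
      ext v
      simp only [e1, s3]
      omega)
    ⟨r, t, (e1 r).2 h1, by rw [s3]; omega, (e2 t).2 h4, by rw [s3]; omega, h5⟩
    ⟨z₁, by have := s1 z₁; omega⟩ ⟨z₂, by have := s2 z₂; omega⟩
  refine ⟨[A', B', C'], by simp, by simp [hA, hB, hC], ?_⟩
  simp only [listSymmDiff, List.foldr_cons, List.foldr_nil, symmDiff_bot]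
  rw [← symmDiff_assoc, hsd]
  have l1 := @h.le₁
  have l2 := @h.le₂
  have hdis : ∀ a b, P₁.Adj a b → ¬ P₂.Adj a b := fun a b h1 h2 =>
    (hd.le_bot : P₁ ⊓ P₂ ≤ ⊥) (show (P₁ ⊓ P₂).Adj a b from ⟨h1, h2⟩)
  ext a b
  have := @l1 a b
  have := @l2 a b
  have := hdis a b
  simp only [symmDiff_def, sup_adj, sdiff_adj]
  tauto

/-- Transversals of two edge-disjoint polycycles whose union is a linear forest with an isolated
path `a₁ x₁ b₁`, and in which both transversals cover a further vertex `x₂`. -/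
structure Config (P₁ P₂ M₁ M₂ : SimpleGraph α) (x₁ a₁ b₁ x₂ : α) : Prop where
  poly₁ : IsPolycycle P₁
  poly₂ : IsPolycycle P₂
  disj : Disjoint P₁ P₂
  le₁ : M₁ ≤ P₁
  le₂ : M₂ ≤ P₂
  deg₁ : ∀ v, degS M₁ v ≤ 1
  deg₂ : ∀ v, degS M₂ v ≤ 1
  hit₁ : ∀ v, 0 < degS P₁ v → ∃ w, P₁.Reachable v w ∧ 0 < degS M₁ w
  hit₂ : ∀ v, 0 < degS P₂ v → ∃ w, P₂.Reachable v w ∧ 0 < degS M₂ w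
  reach₁ : ∀ r s, 0 < degS M₁ r → 0 < degS M₁ s → P₁.Reachable r s → M₁.Reachable r s
  reach₂ : ∀ r s, 0 < degS M₂ r → 0 < degS M₂ s → P₂.Reachable r s → M₂.Reachable r s
  forest : IsLinearForest (M₁ ⊔ M₂)
  adj₁ : M₁.Adj x₁ a₁
  adj₂ : M₂.Adj x₁ b₁
  end₁ : degS M₂ a₁ = 0
  end₂ : degS M₁ b₁ = 0
  mem₁ : 0 < degS M₁ x₂
  mem₂ : 0 < degS M₂ x₂
  ne₁ : ¬ P₁.Reachable x₁ x₂
  ne₂ : ¬ P₂.Reachable x₁ x₂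

variable {x₁ a₁ b₁ x₂ : α}

theorem Config.swap (h : Config P₁ P₂ M₁ M₂ x₁ a₁ b₁ x₂) : Config P₂ P₁ M₂ M₁ x₁ b₁ a₁ x₂ :=
  ⟨h.poly₂, h.poly₁, h.disj.symm, h.le₂, h.le₁, h.deg₂, h.deg₁, h.hit₂, h.hit₁, h.reach₂, h.reach₁,
    sup_comm M₁ M₂ ▸ h.forest, h.adj₂, h.adj₁, h.end₂, h.end₁, h.mem₂, h.mem₁, h.ne₂, h.ne₁⟩

namespace Config

theorem degS_sup [Finite α] (h : Config P₁ P₂ M₁ M₂ x₁ a₁ b₁ x₂) (v : α) :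
    degS (M₁ ⊔ M₂) v = degS M₁ v + degS M₂ v :=
  CycleOddCover.degS_sup (h.disj.mono h.le₁ h.le₂) v

theorem degS_a [Finite α] (h : Config P₁ P₂ M₁ M₂ x₁ a₁ b₁ x₂) : degS M₁ a₁ = 1 :=
  le_antisymm (h.deg₁ _) (degS_pos_of_adj h.adj₁.symm)

theorem degS_b [Finite α] (h : Config P₁ P₂ M₁ M₂ x₁ a₁ b₁ x₂) : degS M₂ b₁ = 1 := h.swap.degS_a

theorem eq_of_reachable [Finite α] (h : Config P₁ P₂ M₁ M₂ x₁ a₁ b₁ x₂) {v : α}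
    (hv : (M₁ ⊔ M₂).Reachable x₁ v) : v = a₁ ∨ v = x₁ ∨ v = b₁ := by
  obtain ⟨w⟩ := hv
  have ha := h.degS_a
  have hb := h.degS_b
  have : ∀ a b : α, (M₁ ⊔ M₂).Walk a b → a = a₁ ∨ a = x₁ ∨ a = b₁ → b = a₁ ∨ b = x₁ ∨ b = b₁ := by
    intro a b w
    induction w with
    | nil => exact id
    | cons hadj w ih =>
      intro ha'
      apply ih
      rcases hadj with hadj | hadj
      · rcases ha' with rfl | rfl | rfl
        · exact Or.inr (Or.inl (eq_of_degS_le_one (h.deg₁ _) hadj h.adj₁.symm))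
        · exact Or.inl (eq_of_degS_le_one (h.deg₁ _) hadj h.adj₁)
        · exact (degS_eq_zero.1 h.end₂ _ hadj).elim
      · rcases ha' with rfl | rfl | rfl
        · exact (degS_eq_zero.1 h.end₁ _ hadj).elim
        · exact Or.inr (Or.inr (eq_of_degS_le_one (h.deg₂ _) hadj h.adj₂))
        · exact Or.inr (Or.inl (eq_of_degS_le_one (h.deg₂ _) hadj h.adj₂.symm))
  exact this _ _ w (Or.inr (Or.inl rfl))

theorem not_reachable [Finite α] (h : Config P₁ P₂ M₁ M₂ x₁ a₁ b₁ x₂) :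
    ¬ (M₁ ⊔ M₂).Reachable x₁ x₂ := by
  intro hr
  have := h.mem₁
  have := h.mem₂
  have := h.end₁
  have := h.end₂
  rcases h.eq_of_reachable hr with rfl | rfl | rfl
  · omega
  · exact h.ne₁ .rfl
  · omega

theorem reachable_a (h : Config P₁ P₂ M₁ M₂ x₁ a₁ b₁ x₂) : (M₁ ⊔ M₂).Reachable x₁ a₁ :=
  (Adj.reachable (G := M₁ ⊔ M₂) (Or.inl h.adj₁))

theorem reachable_b (h : Config P₁ P₂ M₁ M₂ x₁ a₁ b₁ x₂) : (M₁ ⊔ M₂).Reachable x₁ b₁ :=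
  (Adj.reachable (G := M₁ ⊔ M₂) (Or.inr h.adj₂))

/-- Vertices in the component of `x₂` are different from vertices in the component of `x₁`. -/
theorem ne_of_reachable [Finite α] (h : Config P₁ P₂ M₁ M₂ x₁ a₁ b₁ x₂) {v w : α}
    (hv : (M₁ ⊔ M₂).Reachable x₂ v)
    (hw : (M₁ ⊔ M₂).Reachable x₁ w) : v ≠ w := by
  rintro rfl
  exact h.not_reachable (hw.trans hv.symm)

theorem free [Finite α] (h : Config P₁ P₂ M₁ M₂ x₁ a₁ b₁ x₂) :
    ∃ z, P₁.Reachable x₁ z ∧ degS P₁ z = 2 ∧ degS M₁ z = 0 := by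
  obtain ⟨z, hza, hz⟩ := exists_adj_of_isPolycycle h.poly₁ (degS_pos_of_adj (h.le₁ h.adj₁)) a₁
  refine ⟨z, hz.reachable, (h.poly₁ z).resolve_left (degS_pos_of_adj hz.symm).ne', ?_⟩
  by_contra hne
  rcases eq_or_adj_of_reachable h.deg₁ (h.reach₁ x₁ z (degS_pos_of_adj h.adj₁)
    (Nat.pos_of_ne_zero hne) hz.reachable) with rfl | h'
  · exact hz.ne rfl
  · exact hza (eq_of_degS_le_one (h.deg₁ _) h' h.adj₁)

theorem splitting [Finite α] (h : Config P₁ P₂ M₁ M₂ x₁ a₁ b₁ x₂)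
    (heven : Even {v | degS M₁ v = 1 ∧ degS M₂ v = 0}.ncard) :
    Splitting P₁ P₂ M₁ M₂ := by
  obtain ⟨z₁, -, hz₁, hfree₁⟩ := h.free
  obtain ⟨z₂, -, hz₂, hfree₂⟩ := h.swap.free
  exact ⟨h.le₁, h.le₂, h.hit₁, h.hit₂, h.reach₁, h.reach₂, h.forest, heven,
    ⟨a₁, b₁, h.degS_a, h.end₁, h.end₂, h.degS_b, h.reachable_a.symm.trans h.reachable_b⟩,
    ⟨z₁, hz₁, hfree₁⟩, ⟨z₂, hz₂, hfree₂⟩⟩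

/-- An end of the component of `x₂` covered by `M₁` has its `M₁`-neighbour covered by `M₂`. -/
theorem degS_neighbor [Finite α] (h : Config P₁ P₂ M₁ M₂ x₁ a₁ b₁ x₂) {y y' : α}
    (hy : (M₁ ⊔ M₂).Reachable x₂ y) (hy₂ : degS M₂ y = 0)
    (hyy' : M₁.Adj y y') : degS M₂ y' = 1 := by
  by_contra hne
  have := h.deg₁ y'
  have := h.deg₁ y
  have := h.deg₂ y'
  have := h.mem₁
  have := h.mem₂
  have hs := h.degS_sup y
  have hs' := h.degS_sup y'
  rcases eq_or_eq_of_adj_ends (F := M₁ ⊔ M₂) (Or.inl hyy') (by omega) (by omega)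
    hy.symm with rfl | rfl
  · omega
  · omega

/-- The vertex reached by the other edge of `P₁` at a vertex covered by `M₁`. -/
theorem degS_other [Finite α] (h : Config P₁ P₂ M₁ M₂ x₁ a₁ b₁ x₂) {y x₀ : α} (hy : 0 < degS M₁ y)
    (hx₀ : P₁.Adj y x₀) (hn : ¬ M₁.Adj y x₀) :
    degS M₁ x₀ = 0 := by
  by_contra hne
  rcases eq_or_adj_of_reachable h.deg₁ (h.reach₁ y x₀ hy (Nat.pos_of_ne_zero hne)
    hx₀.reachable) with rfl | h'
  · exact hx₀.ne rfl
  · exact hn h'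

theorem flip_add [Finite α] (h : Config P₁ P₂ M₁ M₂ x₁ a₁ b₁ x₂)
    (hodd : ¬ Even {v | degS M₁ v = 1 ∧ degS M₂ v = 0}.ncard) {y x₀ : α}
    (hy : (M₁ ⊔ M₂).Reachable x₂ y) (hy₁ : degS M₁ y = 1) (hy₂ : degS M₂ y = 0)
    (hx₀ : P₁.Adj y x₀) (hn : ¬ M₁.Adj y x₀) (hx₀₂ : degS M₂ x₀ = 1)
    (hr : ¬ (M₁ ⊔ M₂).Reachable y x₀)
    (hb : x₀ ≠ b₁ ∨ ∃ t, degS M₁ t = 0 ∧ degS M₂ t = 1 ∧ (M₁ ⊔ M₂).Reachable y t) :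
    Splitting P₁ P₂ (M₁ ⊔ edge y x₀) M₂ := by
  classical
  have hx₀₁ := h.degS_other (by omega) hx₀ hn
  have hdeg : ∀ v, degS (M₁ ⊔ edge y x₀) v = degS M₁ v + if v = y ∨ v = x₀ then 1 else 0 :=
    degS_add_edge hx₀.ne hn
  have hadj : (M₁ ⊔ edge y x₀).Adj y x₀ := by
    rw [sup_adj, edge_adj]; exact Or.inr ⟨Or.inl ⟨rfl, rfl⟩, hx₀.ne⟩
  have hH : M₁ ⊔ edge y x₀ ⊔ M₂ = M₁ ⊔ M₂ ⊔ edge y x₀ := sup_right_comm _ _ _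
  have hle : M₁ ⊔ M₂ ≤ M₁ ⊔ edge y x₀ ⊔ M₂ := hH ▸ le_sup_left
  obtain ⟨z₁, hxz₁, hz₁, hz₁'⟩ := h.free
  obtain ⟨z₂, -, hz₂, hz₂'⟩ := h.swap.free
  have hyx₁ : ¬ P₁.Reachable x₁ y := fun h' => h.ne_of_reachable hy
    ((h.reach₁ x₁ y (degS_pos_of_adj h.adj₁) (by omega) h').mono le_sup_left) rfl
  have ha := h.degS_a
  have hae := h.end₁
  have hb₁ := h.degS_b
  have hbe := h.end₂
  have hya : y ≠ a₁ := h.ne_of_reachable hy h.reachable_a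
  have hrep : ∀ r, 0 < degS (M₁ ⊔ edge y x₀) r → ∃ r', 0 < degS M₁ r' ∧ P₁.Reachable r r' ∧
      (M₁ ⊔ edge y x₀).Reachable r r' := by
    intro r hr'
    by_cases hrx : r = x₀
    · subst hrx
      exact ⟨y, by omega, hx₀.symm.reachable, hadj.symm.reachable⟩
    · refine ⟨r, ?_, .rfl, .rfl⟩
      rw [hdeg] at hr'
      grind
  refine ⟨sup_le h.le₁ (by rw [edge_le_iff]; exact Or.inr hx₀), h.le₂, ?_, h.hit₂, ?_, h.reach₂, ?_,
    ?_, ?_, ⟨z₁, hz₁, ?_⟩, ⟨z₂, hz₂, hz₂'⟩⟩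
  · intro v hv
    obtain ⟨w, hw, hw'⟩ := h.hit₁ v hv
    exact ⟨w, hw, hw'.trans_le (degS_mono le_sup_left w)⟩
  · intro r s hr hs hrs
    obtain ⟨r', hr', h1, h2⟩ := hrep r hr
    obtain ⟨s', hs', h3, h4⟩ := hrep s hs
    exact h2.trans (((h.reach₁ r' s' hr' hs' (h1.symm.trans (hrs.trans h3))).mono le_sup_left).trans
      h4.symm)
  · rw [hH]
    apply linearForest_join h.forest _ _ hr
    · rw [h.degS_sup]; omega
    · rw [h.degS_sup]; omega
  · have hset : {v | degS M₁ v = 1 ∧ degS M₂ v = 0} =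
        insert y {v | degS (M₁ ⊔ edge y x₀) v = 1 ∧ degS M₂ v = 0} := by
      ext v
      simp only [Set.mem_ofPred_eq, Set.mem_insert_iff, hdeg]
      grind
    rw [hset, Set.ncard_insert_of_notMem _ (Set.toFinite _)] at hodd
    · grind
    · simp only [Set.mem_ofPred_eq, hdeg]
      grind
  · have hda : degS (M₁ ⊔ edge y x₀) a₁ = 1 := by
      rw [hdeg]; grind
    by_cases hxb : x₀ = b₁
    · obtain ⟨t, ht₁, ht₂, hyt⟩ := hb.resolve_left fun h' => h' hxb
      have htx : t ≠ x₀ := by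
        rintro rfl
        exact hr hyt
      refine ⟨a₁, t, hda, hae, ?_, ht₂, ?_⟩
      · rw [hdeg]; grind
      · subst hxb
        refine ((h.reachable_a.symm.trans h.reachable_b).mono hle).trans ?_
        exact (hadj.symm.reachable.mono le_sup_left).trans (hyt.mono hle)
    · refine ⟨a₁, b₁, hda, hae, ?_, hb₁, (h.reachable_a.symm.trans h.reachable_b).mono hle⟩
      rw [hdeg]; grind
  · rw [hdeg, hz₁', if_neg]
    rintro (rfl | rfl)
    · exact hyx₁ hxz₁
    · exact hyx₁ (hxz₁.trans hx₀.symm.reachable)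

theorem flip_move [Finite α] (h : Config P₁ P₂ M₁ M₂ x₁ a₁ b₁ x₂)
    (hodd : ¬ Even {v | degS M₁ v = 1 ∧ degS M₂ v = 0}.ncard) {y y' x₀ : α}
    (hy : (M₁ ⊔ M₂).Reachable x₂ y) (hy₁ : degS M₁ y = 1) (hy₂ : degS M₂ y = 0)
    (hyy' : M₁.Adj y y') (hx₀ : P₁.Adj y x₀) (hn : ¬ M₁.Adj y x₀) (hx₀₂ : degS M₂ x₀ = 0) :
    Splitting P₁ P₂ (M₁ \ edge y y' ⊔ edge y x₀) M₂ := by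
  classical
  have hx₀₁ := h.degS_other (by omega) hx₀ hn
  have hy'₁ : degS M₁ y' = 1 := le_antisymm (h.deg₁ _) (degS_pos_of_adj hyy'.symm)
  have hy'₂ := h.degS_neighbor hy hy₂ hyy'
  have hn' : ¬ (M₁ \ edge y y').Adj y x₀ := fun h' => hn h'.1
  have hyle : edge y y' ≤ M₁ := by rw [edge_le_iff]; exact Or.inr hyy'
  have hdeg' : ∀ v, degS (M₁ \ edge y y') v + (if v = y ∨ v = y' then 1 else 0) = degS M₁ v := by
    intro v
    rw [← degS_edge hyy'.ne, degS_sdiff_add hyle]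
  have hdeg : ∀ v, degS (M₁ \ edge y y' ⊔ edge y x₀) v =
      degS (M₁ \ edge y y') v + if v = y ∨ v = x₀ then 1 else 0 := degS_add_edge hx₀.ne hn'
  have hyy'ne : y ≠ y' := hyy'.ne
  have hyx₀ : y ≠ x₀ := hx₀.ne
  have hy'x₀ : y' ≠ x₀ := by rintro rfl; omega
  have hadj : (M₁ \ edge y y' ⊔ edge y x₀).Adj y x₀ := by
    rw [sup_adj, edge_adj]; exact Or.inr ⟨Or.inl ⟨rfl, rfl⟩, hx₀.ne⟩
  have hH : M₁ \ edge y y' ⊔ edge y x₀ ⊔ M₂ = (M₁ \ edge y y' ⊔ M₂) ⊔ edge y x₀ :=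
    sup_right_comm _ _ _
  have hdisj : Disjoint (M₁ \ edge y y') M₂ := (h.disj.mono h.le₁ h.le₂).mono_left sdiff_le
  obtain ⟨z₁, hxz₁, hz₁, hz₁'⟩ := h.free
  obtain ⟨z₂, -, hz₂, hz₂'⟩ := h.swap.free
  have hyx₁ : ¬ P₁.Reachable x₁ y := fun h' => h.ne_of_reachable hy
    ((h.reach₁ x₁ y (degS_pos_of_adj h.adj₁) (by omega) h').mono le_sup_left) rfl
  have ha := h.degS_a
  have hae := h.end₁
  have hb₁ := h.degS_b
  have hbe := h.end₂
  have hya : y ≠ a₁ := h.ne_of_reachable hy h.reachable_a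
  have hyx : y ≠ x₁ := h.ne_of_reachable hy .rfl
  have hpos : ∀ v, 0 < degS (M₁ \ edge y y' ⊔ edge y x₀) v ↔ v = x₀ ∨ (0 < degS M₁ v ∧ v ≠ y') := by
    intro v
    rw [hdeg]
    have := hdeg' v
    have := h.deg₁ v
    grind
  have hcomp : ∀ v, 0 < degS (M₁ \ edge y y' ⊔ edge y x₀) v → P₁.Reachable y v →
      v = y ∨ v = x₀ := by
    intro v hv hyv
    rcases (hpos v).1 hv with h' | ⟨h', hvy'⟩
    · exact Or.inr h'
    · left
      rcases eq_or_adj_of_reachable h.deg₁ (h.reach₁ y v (by omega) h' hyv) with hlast | hlast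
      · exact hlast
      · exact (hvy' (eq_of_degS_le_one (h.deg₁ _) hlast hyy')).elim
  have hreach : ∀ v w, (v = y ∨ v = x₀) → (w = y ∨ w = x₀) →
      (M₁ \ edge y y' ⊔ edge y x₀).Reachable v w := by
    rintro v w (rfl | rfl) (rfl | rfl)
    · exact .rfl
    · exact hadj.reachable
    · exact hadj.symm.reachable
    · exact .rfl
  have hPy : ∀ v, (v = y ∨ v = x₀) → P₁.Reachable y v := by
    rintro v (rfl | rfl)
    · exact .rfl
    · exact hx₀.reachable
  have hadja : (M₁ \ edge y y' ⊔ edge y x₀).Adj x₁ a₁ := by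
    refine Or.inl ⟨h.adj₁, ?_⟩
    rw [edge_adj]
    grind
  refine ⟨sup_le (sdiff_le.trans h.le₁) (by rw [edge_le_iff]; exact Or.inr hx₀), h.le₂, ?_, h.hit₂,
    ?_, h.reach₂, ?_, ?_, ?_, ⟨z₁, hz₁, ?_⟩, ⟨z₂, hz₂, hz₂'⟩⟩
  · intro v hv
    obtain ⟨w, hw, hw'⟩ := h.hit₁ v hv
    by_cases hwy : w = y'
    · subst hwy
      exact ⟨y, hw.trans (h.le₁ hyy').symm.reachable, (hpos y).2 (Or.inr ⟨by omega, hyy'ne⟩)⟩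
    · exact ⟨w, hw, (hpos w).2 (Or.inr ⟨hw', hwy⟩)⟩
  · intro r s hr hs hrs
    by_cases hyr : P₁.Reachable y r
    · exact hreach r s (hcomp r hr hyr) (hcomp s hs (hyr.trans hrs))
    have hys : ¬ P₁.Reachable y s := fun h' => hyr (h'.trans hrs.symm)
    have hr' := ((hpos r).1 hr).resolve_left fun h' => hyr (hPy r (Or.inr h'))
    have hs' := ((hpos s).1 hs).resolve_left fun h' => hys (hPy s (Or.inr h'))
    rcases eq_or_adj_of_reachable h.deg₁ (h.reach₁ r s hr'.1 hs'.1 hrs) with rfl | h'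
    · exact .rfl
    · refine Adj.reachable (Or.inl ⟨h', ?_⟩)
      rw [edge_adj]
      grind
  · rw [hH]
    have hd0 : degS (M₁ \ edge y y' ⊔ M₂) y = 0 := by
      rw [CycleOddCover.degS_sup hdisj, hy₂]
      have := hdeg' y
      grind
    refine linearForest_join (linearForest_mono (sup_le_sup_right sdiff_le _) h.forest)
      (by omega) ?_
      fun h' => hyx₀ (eq_of_reachable_of_degS_eq_zero hd0 h')
    rw [CycleOddCover.degS_sup hdisj]
    have := hdeg' x₀
    omega
  · have hset : {v | degS (M₁ \ edge y y' ⊔ edge y x₀) v = 1 ∧ degS M₂ v = 0} =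
        insert x₀ {v | degS M₁ v = 1 ∧ degS M₂ v = 0} := by
      ext v
      simp only [Set.mem_ofPred_eq, Set.mem_insert_iff, hdeg]
      have := hdeg' v
      grind
    rw [hset, Set.ncard_insert_of_notMem _ (Set.toFinite _)]
    · grind
    · simp only [Set.mem_ofPred_eq]
      omega
  · refine ⟨a₁, b₁, ?_, hae, ?_, hb₁, ?_⟩
    · rw [hdeg]
      have := hdeg' a₁
      grind
    · rw [hdeg]
      have := hdeg' b₁
      grind
    · exact (hadja.symm.reachable.mono le_sup_left).trans (h.adj₂.reachable.mono le_sup_right)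
  · have := hdeg' z₁
    rw [hdeg, if_neg]
    · omega
    rintro (rfl | rfl)
    · exact hyx₁ hxz₁
    · exact hyx₁ (hxz₁.trans hx₀.symm.reachable)

theorem exists_cycles_of_flip [Finite α] (h : Config P₁ P₂ M₁ M₂ x₁ a₁ b₁ x₂)
    (hodd : ¬ Even {v | degS M₁ v = 1 ∧ degS M₂ v = 0}.ncard) {y x₀ : α}
    (hy : (M₁ ⊔ M₂).Reachable x₂ y) (hy₁ : degS M₁ y = 1) (hy₂ : degS M₂ y = 0)
    (hx₀ : P₁.Adj y x₀) (hn : ¬ M₁.Adj y x₀)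
    (hc : degS M₂ x₀ = 0 ∨ (¬ (M₁ ⊔ M₂).Reachable y x₀ ∧
      (x₀ ≠ b₁ ∨ ∃ t, degS M₁ t = 0 ∧ degS M₂ t = 1 ∧ (M₁ ⊔ M₂).Reachable y t))) :
    ∃ L : List (SimpleGraph α), L.length ≤ 3 ∧ (∀ C ∈ L, IsCycleGraph C) ∧
      listSymmDiff L = P₁ ⊔ P₂ := by
  obtain ⟨y', hyy'⟩ := degS_pos.1 (show 0 < degS M₁ y by omega)
  by_cases h0 : degS M₂ x₀ = 0
  · exact (h.flip_move hodd hy hy₁ hy₂ hyy' hx₀ hn h0).exists_three_cycles h.poly₁ h.poly₂ h.disj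
  · have h1 : degS M₂ x₀ = 1 := by have := h.deg₂ x₀; omega
    obtain ⟨hr, hb⟩ := hc.resolve_left h0
    exact (h.flip_add hodd hy hy₁ hy₂ hx₀ hn h1 hr hb).exists_three_cycles h.poly₁ h.poly₂ h.disj

theorem exists_other [Finite α] (h : Config P₁ P₂ M₁ M₂ x₁ a₁ b₁ x₂) {y : α} (hy : degS M₁ y = 1) :
    ∃ x₀, P₁.Adj y x₀ ∧ ¬ M₁.Adj y x₀ := by
  obtain ⟨y', hyy'⟩ := degS_pos.1 (show 0 < degS M₁ y by omega)
  obtain ⟨x₀, hne, hx₀⟩ := exists_adj_of_isPolycycle h.poly₁ (degS_pos_of_adj (h.le₁ hyy')) y'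
  exact ⟨x₀, hx₀, fun h' => hne (eq_of_degS_le_one hy.le h' hyy')⟩

theorem exists_cycles_of_pure [Finite α] (h : Config P₁ P₂ M₁ M₂ x₁ a₁ b₁ x₂)
    (hodd : ¬ Even {v | degS M₁ v = 1 ∧ degS M₂ v = 0}.ncard) {y z : α} (hyz : y ≠ z)
    (hy : (M₁ ⊔ M₂).Reachable x₂ y) (hy₁ : degS M₁ y = 1) (hy₂ : degS M₂ y = 0)
    (hz : (M₁ ⊔ M₂).Reachable x₂ z) (hz₁ : degS M₁ z = 1) (hz₂ : degS M₂ z = 0) :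
    ∃ L : List (SimpleGraph α), L.length ≤ 3 ∧ (∀ C ∈ L, IsCycleGraph C) ∧
      listSymmDiff L = P₁ ⊔ P₂ := by
  have key : ∀ {y z x₀ : α}, y ≠ z → (M₁ ⊔ M₂).Reachable x₂ y → degS M₁ y = 1 → degS M₂ y = 0 →
      (M₁ ⊔ M₂).Reachable x₂ z → degS M₁ z = 1 → degS M₂ z = 0 → P₁.Adj y x₀ → ¬ M₁.Adj y x₀ →
      degS M₂ x₀ = 0 ∨ ¬ (M₁ ⊔ M₂).Reachable y x₀ := by
    intro y z x₀ hyz hy hy₁ hy₂ hz hz₁ hz₂ hx₀ hn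
    by_contra! hc
    have h1 := h.degS_other (by omega) hx₀ hn
    have h2 := h.deg₂ x₀
    have := eq_of_three_ends h.forest (a := y) (b := x₀) (c := z)
      (by rw [h.degS_sup]; omega) (by rw [h.degS_sup]; omega) (by rw [h.degS_sup]; omega)
      hx₀.ne hyz hc.2 (hy.symm.trans hz)
    subst this
    omega
  obtain ⟨u, hu, hun⟩ := h.exists_other hy₁
  obtain ⟨w, hw, hwn⟩ := h.exists_other hz₁
  have hku := key hyz hy hy₁ hy₂ hz hz₁ hz₂ hu hun
  have hkw := key hyz.symm hz hz₁ hz₂ hy hy₁ hy₂ hw hwn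
  by_cases hub : u = b₁
  · have hwb : w ≠ b₁ := by
      rintro rfl
      subst hub
      rcases eq_or_adj_of_reachable h.deg₁ (h.reach₁ y z (by omega) (by omega)
        (hu.reachable.trans hw.symm.reachable)) with h' | h'
      · exact hyz h'.symm
      · have := h.degS_neighbor hy hy₂ h'
        omega
    exact h.exists_cycles_of_flip hodd hz hz₁ hz₂ hw hwn (hkw.imp_right fun h' => ⟨h', Or.inl hwb⟩)
  · exact h.exists_cycles_of_flip hodd hy hy₁ hy₂ hu hun (hku.imp_right fun h' => ⟨h', Or.inl hub⟩)

theorem exists_cycles_of_mixed [Finite α] (h : Config P₁ P₂ M₁ M₂ x₁ a₁ b₁ x₂)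
    (hodd : ¬ Even {v | degS M₁ v = 1 ∧ degS M₂ v = 0}.ncard) {y z u : α}
    (hy : (M₁ ⊔ M₂).Reachable x₂ y) (hy₁ : degS M₁ y = 1) (hy₂ : degS M₂ y = 0)
    (hz : (M₁ ⊔ M₂).Reachable x₂ z) (hz₁ : degS M₁ z = 0) (hz₂ : degS M₂ z = 1)
    (hu : P₁.Adj y u) (hun : ¬ M₁.Adj y u) (huz : u ≠ z) :
    ∃ L : List (SimpleGraph α), L.length ≤ 3 ∧ (∀ C ∈ L, IsCycleGraph C) ∧
      listSymmDiff L = P₁ ⊔ P₂ := by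
  refine h.exists_cycles_of_flip hodd hy hy₁ hy₂ hu hun (Or.inr ⟨?_, Or.inr
    ⟨z, hz₁, hz₂, hy.symm.trans hz⟩⟩)
  intro hr
  have hyz : y ≠ z := by rintro rfl; omega
  have h1 := h.degS_other (by omega) hu hun
  have h2 := h.deg₂ u
  exact huz (eq_of_three_ends h.forest (a := y) (b := u) (c := z)
      (by rw [h.degS_sup]; omega) (by rw [h.degS_sup]; omega) (by rw [h.degS_sup]; omega)
      hu.ne hyz hr (hy.symm.trans hz))

theorem exists_three_cycles [Finite α] (h : Config P₁ P₂ M₁ M₂ x₁ a₁ b₁ x₂) :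
    ∃ L : List (SimpleGraph α), L.length ≤ 3 ∧ (∀ C ∈ L, IsCycleGraph C) ∧
      listSymmDiff L = P₁ ⊔ P₂ := by
  by_cases hev : Even {v | degS M₁ v = 1 ∧ degS M₂ v = 0}.ncard
  · exact (h.splitting hev).exists_three_cycles h.poly₁ h.poly₂ h.disj
  have hev' := hev
  rw [even_ncard_iff (h.disj.mono h.le₁ h.le₂) h.forest] at hev'
  have hmix : ∀ {y z}, (M₁ ⊔ M₂).Reachable x₂ y → degS M₁ y = 1 → degS M₂ y = 0 →
      (M₁ ⊔ M₂).Reachable x₂ z → degS M₁ z = 0 → degS M₂ z = 1 →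
      ∃ L : List (SimpleGraph α), L.length ≤ 3 ∧ (∀ C ∈ L, IsCycleGraph C) ∧
        listSymmDiff L = P₁ ⊔ P₂ := by
    intro y z hy hy₁ hy₂ hz hz₁ hz₂
    obtain ⟨u, hu, hun⟩ := h.exists_other hy₁
    obtain ⟨w, hw, hwn⟩ := h.swap.exists_other hz₂
    by_cases huz : u = z
    · have hwy : w ≠ y := by
        rintro rfl
        subst huz
        exact (h.disj.le_bot : P₁ ⊓ P₂ ≤ ⊥) (show (P₁ ⊓ P₂).Adj _ _ from ⟨hu, hw.symm⟩)
      rw [sup_comm P₁ P₂]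
      rw [sup_comm M₁ M₂] at hy hz
      exact h.swap.exists_cycles_of_mixed hev' hz hz₂ hz₁ hy hy₂ hy₁ hw hwn hwy
    · exact h.exists_cycles_of_mixed hev hy hy₁ hy₂ hz hz₁ hz₂ hu hun huz
  obtain ⟨y, hy, hy1⟩ := exists_end_of_pos h.forest (v := x₂) (by
    have := h.mem₁; rw [h.degS_sup]; omega)
  obtain ⟨z, hzy, hyz, hz1⟩ := exists_partner h.forest hy1
  have hz := hy.trans hyz
  rw [h.degS_sup] at hy1 hz1
  obtain ⟨hy₁, hy₂⟩ | ⟨hy₁, hy₂⟩ :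
      (degS M₁ y = 1 ∧ degS M₂ y = 0) ∨ (degS M₁ y = 0 ∧ degS M₂ y = 1) := by
    omega
  all_goals
    obtain ⟨hz₁, hz₂⟩ | ⟨hz₁, hz₂⟩ :
        (degS M₁ z = 1 ∧ degS M₂ z = 0) ∨ (degS M₁ z = 0 ∧ degS M₂ z = 1) := by
      omega
  · exact h.exists_cycles_of_pure hev hzy.symm hy hy₁ hy₂ hz hz₁ hz₂
  · exact hmix hy hy₁ hy₂ hz hz₁ hz₂
  · exact hmix hz hz₁ hz₂ hy hy₁ hy₂
  · rw [sup_comm P₁ P₂]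
    rw [sup_comm M₁ M₂] at hy hz
    exact h.swap.exists_cycles_of_pure hev' hzy.symm hy hy₂ hy₁ hz hz₂ hz₁

end Config

end Splitting

section Pair

theorem PartialTransversal.exists_avoiding [Finite α] {P M N : SimpleGraph α}
    (h : PartialTransversal P M N)
    (hP : IsPolycycle P) (hN : ∀ v, degS N v ≤ 1) (hPN : Disjoint P N) {v : α} (hv : degS M v = 0)
    (hr : (∀ w, P.Reachable v w → degS M w = 0) → ∀ u w, P.Reachable v u → P.Adj u w →
      ¬ (M ⊔ N).Reachable u w) :
    ∃ M', PartialTransversal P M' N ∧ M ≤ M' ∧ degS M' v = 0 ∧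
      (0 < degS P v → ∃ w, P.Reachable v w ∧ 0 < degS M' w) ∧
      ∀ x, 0 < degS M' x → 0 < degS M x ∨ P.Reachable v x := by
  classical
  by_cases hit : 0 < degS P v → ∃ w, P.Reachable v w ∧ 0 < degS M w
  · exact ⟨M, h, le_rfl, hv, hit, fun x hx => Or.inl hx⟩
  push Not at hit
  obtain ⟨hv0, hun⟩ := hit
  replace hun : ∀ w, P.Reachable v w → degS M w = 0 := fun w hw => Nat.le_zero.1 (hun w hw)
  obtain ⟨u, hu⟩ := degS_pos.1 hv0
  obtain ⟨w, hwv, hw⟩ := exists_adj_of_isPolycycle hP (degS_pos_of_adj hu.symm) v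
  have hruw := hr hun u w hu.reachable hw
  have hna : ¬ M.Adj u w := fun h' => hruw ((Adj.reachable h').mono le_sup_left)
  refine ⟨M ⊔ edge u w, h.add_edge hN hPN hw (fun x hx => hun x (hu.reachable.trans hx)) hruw,
    le_sup_left, ?_, fun _ => ⟨u, hu.reachable, ?_⟩, fun x hx => ?_⟩
  · rw [degS_add_edge hw.ne hna, hv, if_neg]
    rintro (rfl | rfl)
    · exact hu.ne rfl
    · exact hwv rfl
  · rw [degS_add_edge hw.ne hna, if_pos (Or.inl rfl)]
    omega
  · rw [degS_add_edge hw.ne hna] at hx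
    split_ifs at hx with hxu
    · right
      rcases hxu with rfl | rfl
      · exact hu.reachable
      · exact hu.reachable.trans hw.reachable
    · exact Or.inl hx

theorem edge_self_adj {p q : α} (h : p ≠ q) : (edge p q).Adj p q := by
  rw [edge_adj]; exact ⟨Or.inl ⟨rfl, rfl⟩, h⟩

theorem exists_config [Finite α] {P₁ P₂ : SimpleGraph α} (hP₁ : IsPolycycle P₁)
    (hP₂ : IsPolycycle P₂)
    (hd : Disjoint P₁ P₂) {x₁ x₂ : α} (h11 : 0 < degS P₁ x₁) (h12 : 0 < degS P₁ x₂)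
    (h21 : 0 < degS P₂ x₁) (h22 : 0 < degS P₂ x₂) (hr₁ : ¬ P₁.Reachable x₁ x₂)
    (hr₂ : ¬ P₂.Reachable x₁ x₂) :
    ∃ M₁ M₂ a₁ b₁, Config P₁ P₂ M₁ M₂ x₁ a₁ b₁ x₂ := by
  classical
  have hdis : ∀ {a b}, P₁.Adj a b → P₂.Adj a b → False := fun h1 h2 =>
    (hd.le_bot : P₁ ⊓ P₂ ≤ ⊥) (show (P₁ ⊓ P₂).Adj _ _ from ⟨h1, h2⟩)
  have hx12 : x₁ ≠ x₂ := fun h => hr₁ (h ▸ .rfl)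
  obtain ⟨a₁, ha₁⟩ := degS_pos.1 h11
  obtain ⟨b₁, hb₁⟩ := degS_pos.1 h21
  have hab : a₁ ≠ b₁ := by rintro rfl; exact hdis ha₁ hb₁
  have hb₁x₂ : b₁ ≠ x₂ := by rintro rfl; exact hr₂ hb₁.reachable
  have ha₁x₂ : a₁ ≠ x₂ := by rintro rfl; exact hr₁ ha₁.reachable
  -- the first transversal
  obtain ⟨M₁, hM₁, hM₁a, hM₁x₂, hM₁b, hit₁⟩ : ∃ M₁, PartialTransversal P₁ M₁ ⊥ ∧ M₁.Adj x₁ a₁ ∧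
      0 < degS M₁ x₂ ∧ degS M₁ b₁ = 0 ∧
      ∀ v, 0 < degS P₁ v → ∃ w, P₁.Reachable v w ∧ 0 < degS M₁ w := by
    have hb : ∀ v, degS (⊥ : SimpleGraph α) v ≤ 1 := fun v => by simp [degS_bot]
    have hiso : ∀ {M : SimpleGraph α} {y z : α}, P₁.Adj y z → degS M y = 0 →
        ¬ (M ⊔ ⊥).Reachable y z := by
      intro M y z hyz hy hr
      rw [sup_bot_eq] at hr
      exact hyz.ne (eq_of_reachable_of_degS_eq_zero hy hr)
    have h0 : PartialTransversal P₁ ⊥ ⊥ := partialTransversal_bot isLinearForest_bot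
    have h1 := h0.add_edge hb disjoint_bot_right ha₁ (fun w _ => degS_bot w)
      (hiso ha₁ (degS_bot _))
    rw [bot_sup_eq] at h1
    obtain ⟨a₂, ha₂b, ha₂⟩ := exists_adj_of_isPolycycle hP₁ h12 b₁
    have hun : ∀ w, P₁.Reachable x₂ w → degS (edge x₁ a₁) w = 0 := by
      intro w hw
      rw [degS_edge ha₁.ne, if_neg]
      rintro (rfl | rfl)
      · exact hr₁ hw.symm
      · exact hr₁ (ha₁.reachable.trans hw.symm)
    have h2 := h1.add_edge hb disjoint_bot_right ha₂ hun (hiso ha₂ (hun _ .rfl))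
    have hna : ¬ (edge x₁ a₁).Adj x₂ a₂ := fun h' => by
      have := degS_pos_of_adj h'
      have := hun _ .rfl
      omega
    have hb0 : degS (edge x₁ a₁ ⊔ edge x₂ a₂) b₁ = 0 := by
      rw [degS_add_edge ha₂.ne hna, degS_edge ha₁.ne]
      have := hb₁.ne
      grind
    obtain ⟨M, hM, hle, hMb, hMhit, -⟩ := h2.exists_avoiding hP₁ hb disjoint_bot_right hb0
      (fun hu u w huv huw => hiso huw (hu u huv))
    obtain ⟨M₁, hM₁, hle₁, hit, hnew⟩ := hM.exists_hitting hP₁ hb disjoint_bot_right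
    refine ⟨M₁, hM₁, hle₁ (hle (Or.inl (edge_self_adj ha₁.ne))),
      degS_pos_of_adj (hle₁ (hle (Or.inr (edge_self_adj ha₂.ne)))), ?_, hit⟩
    by_contra hne
    rcases hnew b₁ (Nat.pos_of_ne_zero hne) with h' | h'
    · omega
    · obtain ⟨w, hw, hw'⟩ := hMhit ((Nat.pos_of_ne_zero hne).trans_le (degS_mono hM₁.le _))
      have := h' w hw
      omega
  have hPN : Disjoint P₂ M₁ := (hd.mono_left hM₁.le).symm
  have hN := hM₁.deg_le
  have h0 : PartialTransversal P₂ ⊥ M₁ := partialTransversal_bot (by simpa using hM₁.forest)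
  have h1 := h0.add_edge hN hPN hb₁ (fun w _ => degS_bot w) (by
    rw [bot_sup_eq]
    exact fun h' => hb₁.ne.symm (eq_of_reachable_of_degS_eq_zero hM₁b h'.symm))
  rw [bot_sup_eq] at h1
  have hnot : ∀ u w, P₂.Adj u w → ¬ P₂.Reachable x₁ u → ¬ (edge x₁ b₁ ⊔ M₁).Reachable u w := by
    intro u w huw hu hr
    rw [sup_comm, reachable_add_edge hb₁.ne] at hr
    rcases hr with hr | ⟨-, hr⟩ | ⟨hr, -⟩
    · rcases eq_or_adj_of_reachable hN hr with rfl | h'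
      · exact huw.ne rfl
      · exact hdis (hM₁.le h') huw
    · have := eq_of_reachable_of_degS_eq_zero hM₁b hr
      subst this
      exact hu (hb₁.reachable.trans huw.symm.reachable)
    · have := eq_of_reachable_of_degS_eq_zero hM₁b hr.symm
      subst this
      exact hu hb₁.reachable
  have hcov : ∀ w, 0 < degS (edge x₁ b₁) w → P₂.Reachable x₁ w := by
    intro w hw
    rw [degS_edge hb₁.ne] at hw
    split_ifs at hw with h'
    · rcases h' with rfl | rfl
      · exact .rfl
      · exact hb₁.reachable
    · omega
  have hxpos : 0 < degS (edge x₁ b₁) x₁ := degS_pos_of_adj (edge_self_adj hb₁.ne)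
  have ha0 : degS (edge x₁ b₁) a₁ = 0 := by
    rw [degS_edge hb₁.ne, if_neg]
    rintro (rfl | rfl)
    · exact ha₁.ne rfl
    · exact hab rfl
  have hun : ∀ w, P₂.Reachable x₂ w → degS (edge x₁ b₁) w = 0 := by
    intro w hw
    by_contra hne
    exact hr₂ ((hcov w (Nat.pos_of_ne_zero hne)).trans hw.symm)
  obtain ⟨M, hM, hle, hMx₂, hMa, hMhit⟩ : ∃ M, PartialTransversal P₂ M M₁ ∧ edge x₁ b₁ ≤ M ∧
      0 < degS M x₂ ∧ degS M a₁ = 0 ∧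
      (0 < degS P₂ a₁ → ∃ w, P₂.Reachable a₁ w ∧ 0 < degS M w) := by
    by_cases hax : P₂.Reachable x₂ a₁
    · obtain ⟨b₂, hb₂a, hb₂⟩ := exists_adj_of_isPolycycle hP₂ h22 a₁
      have hr := hnot x₂ b₂ hb₂ hr₂
      have hna : ¬ (edge x₁ b₁).Adj x₂ b₂ := fun h' => hr ((Adj.reachable h').mono le_sup_left)
      have hx₂ : 0 < degS (edge x₁ b₁ ⊔ edge x₂ b₂) x₂ :=
        degS_pos_of_adj (Or.inr (edge_self_adj hb₂.ne))
      refine ⟨_, h1.add_edge hN hPN hb₂ hun hr, le_sup_left, hx₂, ?_, fun _ => ⟨x₂, hax.symm, hx₂⟩⟩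
      rw [degS_add_edge hb₂.ne hna, ha0, if_neg]
      rintro (h' | h')
      · exact ha₁x₂ h'
      · exact hb₂a h'.symm
    · obtain ⟨M, hM, hle, hMa, hMhit, hnew⟩ := h1.exists_avoiding hP₂ hN hPN ha0
        (fun hu u w hau huw => hnot u w huw fun h' => by
          have := hu x₁ (hau.trans h'.symm)
          omega)
      have hun' : ∀ w, P₂.Reachable x₂ w → degS M w = 0 := by
        intro w hw
        by_contra hne
        rcases hnew w (Nat.pos_of_ne_zero hne) with h' | h'
        · have := hun w hw
          omega
        · exact hax (hw.trans h'.symm)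
      obtain ⟨b₂, hb₂, hr⟩ := hM.exists_adj hP₂ hN hPN h22 hun'
      have hna : ¬ M.Adj x₂ b₂ := fun h' => hr ((Adj.reachable h').mono le_sup_left)
      refine ⟨_, hM.add_edge hN hPN hb₂ hun' hr, hle.trans le_sup_left,
        degS_pos_of_adj (Or.inr (edge_self_adj hb₂.ne)), ?_, fun h' => ?_⟩
      · rw [degS_add_edge hb₂.ne hna, hMa, if_neg]
        rintro (h' | rfl)
        · exact ha₁x₂ h'
        · exact hax hb₂.reachable
      · obtain ⟨w, hw, hw'⟩ := hMhit h'
        exact ⟨w, hw, hw'.trans_le (degS_mono le_sup_left w)⟩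
  obtain ⟨M₂, hM₂, hle₂, hit₂, hnew⟩ := hM.exists_hitting hP₂ hN hPN
  refine ⟨M₁, M₂, a₁, b₁, hP₁, hP₂, hd, hM₁.le, hM₂.le, hM₁.deg_le, hM₂.deg_le, hit₁, hit₂,
    hM₁.reach, hM₂.reach, sup_comm M₂ M₁ ▸ hM₂.forest, hM₁a, hle₂ (hle (edge_self_adj hb₁.ne)), ?_,
    hM₁b, hM₁x₂, hMx₂.trans_le (degS_mono hle₂ _), hr₁, hr₂⟩
  by_contra hne
  rcases hnew a₁ (Nat.pos_of_ne_zero hne) with h' | h'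
  · omega
  · obtain ⟨w, hw, hw'⟩ := hMhit ((Nat.pos_of_ne_zero hne).trans_le (degS_mono hM₂.le _))
    have := h' w hw
    omega

/-- The component of `v` as a graph on the whole vertex type. -/
def componentGraph (P : SimpleGraph α) (v : α) : SimpleGraph α where
  Adj a b := P.Adj a b ∧ P.Reachable v a
  symm := ⟨fun _ _ h => ⟨h.1.symm, h.2.trans h.1.reachable⟩⟩
  loopless := ⟨fun _ h => h.1.ne rfl⟩

theorem componentGraph_le (P : SimpleGraph α) (v : α) : componentGraph P v ≤ P := fun _ _ h => h.1

theorem degS_componentGraph_of_reachable {P : SimpleGraph α} {v w : α} (h : P.Reachable v w) :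
    degS (componentGraph P v) w = degS P w := by
  unfold degS
  congr 1
  ext x
  exact ⟨fun h' => h'.1, fun h' => ⟨h', h⟩⟩

theorem degS_componentGraph_of_not_reachable [Finite α] {P : SimpleGraph α} {v w : α}
    (h : ¬ P.Reachable v w) : degS (componentGraph P v) w = 0 :=
  degS_eq_zero.2 fun _ h' => h h'.2

theorem reachable_componentGraph {P : SimpleGraph α} {v w : α} (h : P.Reachable v w) :
    (componentGraph P v).Reachable v w := by
  obtain ⟨p⟩ := h
  have : ∀ a b : α, P.Walk a b → P.Reachable v a → (componentGraph P v).Reachable v a →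
      (componentGraph P v).Reachable v b := by
    intro a b p
    induction p with
    | nil => exact fun _ => id
    | cons hadj p ih =>
      intro h1 h2
      exact ih (h1.trans hadj.reachable)
        (h2.trans (Adj.reachable (G := componentGraph P v) ⟨hadj, h1⟩))
  exact this _ _ p .rfl .rfl

theorem isCycleGraph_componentGraph [Finite α] {P : SimpleGraph α} (hP : IsPolycycle P) {v : α}
    (hv : 0 < degS P v) : IsCycleGraph (componentGraph P v) := by
  refine ⟨?_, ?_, ?_⟩
  · intro h
    have := degS_componentGraph_of_reachable (P := P) (v := v) (w := v) .rfl
    rw [h, degS_bot] at this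
    omega
  · intro w
    by_cases hw : P.Reachable v w
    · rw [degS_componentGraph_of_reachable hw]
      exact hP w
    · exact Or.inl (degS_componentGraph_of_not_reachable hw)
  · have : ∀ w, 0 < degS (componentGraph P v) w → (componentGraph P v).Reachable v w := by
      intro w hw
      apply reachable_componentGraph
      by_contra h
      rw [degS_componentGraph_of_not_reachable h] at hw
      omega
    exact fun a b ha hb => (this a ha).symm.trans (this b hb)

/-- If all common vertices of two edge-disjoint polycycles lie in one component of the first, then
three cycles suffice. -/
theorem exists_three_cycles_of_common [Finite α] {P₁ P₂ : SimpleGraph α} (hP₁ : IsPolycycle P₁)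
    (hP₂ : IsPolycycle P₂) (hd : Disjoint P₁ P₂)
    (hc : ∀ x y, 0 < degS P₁ x → 0 < degS P₂ x → 0 < degS P₁ y → 0 < degS P₂ y →
      P₁.Reachable x y) :
    ∃ L : List (SimpleGraph α), L.length ≤ 3 ∧ (∀ C ∈ L, IsCycleGraph C) ∧
      listSymmDiff L = P₁ ⊔ P₂ := by
  obtain ⟨L₁, hL₁, hcyc₁, hle, h0⟩ : ∃ L₁ : List (SimpleGraph α), L₁.length ≤ 1 ∧
      (∀ C ∈ L₁, IsCycleGraph C) ∧ listSymmDiff L₁ ≤ P₁ ∧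
      ∀ w, (degS (listSymmDiff L₁) w = degS P₁ w) ∨
        (degS (listSymmDiff L₁) w = 0 ∧ (degS P₁ w = 0 ∨ degS P₂ w = 0)) := by
    by_cases hex : ∃ x, 0 < degS P₁ x ∧ 0 < degS P₂ x
    · obtain ⟨x, hx₁, hx₂⟩ := hex
      refine ⟨[componentGraph P₁ x], by simp, by simpa using isCycleGraph_componentGraph hP₁ hx₁,
        by simpa [listSymmDiff] using componentGraph_le P₁ x, fun w => ?_⟩
      simp only [listSymmDiff, List.foldr_cons, List.foldr_nil, symmDiff_bot]
      by_cases hw : P₁.Reachable x w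
      · exact Or.inl (degS_componentGraph_of_reachable hw)
      · refine Or.inr ⟨degS_componentGraph_of_not_reachable hw, ?_⟩
        by_contra! h
        exact hw (hc x w hx₁ hx₂ (Nat.pos_of_ne_zero h.1) (Nat.pos_of_ne_zero h.2))
    · push Not at hex
      refine ⟨[], by simp, by simp, by simp [listSymmDiff], fun w => Or.inr ⟨?_, ?_⟩⟩
      · simp [listSymmDiff, degS_bot]
      · have := hex w
        omega
  set K := listSymmDiff L₁ with hK
  have hs := degS_sdiff_add hle
  have hd' : Disjoint (P₁ \ K) P₂ := hd.mono_left sdiff_le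
  have hQ : IsPolycycle (P₁ \ K ⊔ P₂) := by
    intro v
    rw [degS_sup hd']
    have := hs v
    have := h0 v
    rcases hP₁ v with h1 | h1 <;> rcases hP₂ v with h2 | h2 <;> omega
  obtain ⟨L₂, hL₂, hcyc₂, hsum⟩ := exists_two_cycles_of_isPolycycle hQ
  refine ⟨L₁ ++ L₂, by rw [List.length_append]; omega, ?_, ?_⟩
  · intro C hC
    rcases List.mem_append.1 hC with h | h
    · exact hcyc₁ C h
    · exact hcyc₂ C h
  · rw [listSymmDiff_append, hsum, ← hK]
    have hdK : Disjoint K (P₁ \ K ⊔ P₂) :=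
      Disjoint.sup_right disjoint_sdiff_self_right (hd.mono_left hle)
    rw [hdK.symmDiff_eq_sup, ← sup_assoc, sup_comm K, sdiff_sup_cancel hle]

theorem exists_three_cycles_of_isPolycycle [Finite α] {P₁ P₂ : SimpleGraph α} (hP₁ : IsPolycycle P₁)
    (hP₂ : IsPolycycle P₂) (hd : Disjoint P₁ P₂) :
    ∃ L : List (SimpleGraph α), L.length ≤ 3 ∧ (∀ C ∈ L, IsCycleGraph C) ∧
      listSymmDiff L = P₁ ⊔ P₂ := by
  by_cases hex : ∃ x y, 0 < degS P₁ x ∧ 0 < degS P₂ x ∧ 0 < degS P₁ y ∧ 0 < degS P₂ y ∧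
      ¬ P₁.Reachable x y ∧ ¬ P₂.Reachable x y
  · obtain ⟨x, y, h1, h2, h3, h4, h5, h6⟩ := hex
    obtain ⟨M₁, M₂, a, b, h⟩ := exists_config hP₁ hP₂ hd h1 h3 h2 h4 h5 h6
    exact h.exists_three_cycles
  push Not at hex
  by_cases hc : ∀ x y, 0 < degS P₁ x → 0 < degS P₂ x → 0 < degS P₁ y → 0 < degS P₂ y →
      P₁.Reachable x y
  · exact exists_three_cycles_of_common hP₁ hP₂ hd hc
  push Not at hc
  obtain ⟨x, y, hx₁, hx₂, hy₁, hy₂, hxy⟩ := hc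
  have hxy' := hex x y hx₁ hx₂ hy₁ hy₂ hxy
  have key : ∀ w, 0 < degS P₂ w → 0 < degS P₁ w → P₂.Reachable x w := by
    intro w hw₂ hw₁
    by_cases hxw : P₁.Reachable x w
    · have hyw : ¬ P₁.Reachable y w := fun h => hxy (hxw.trans h.symm)
      exact hxy'.trans (hex y w hy₁ hy₂ hw₁ hw₂ hyw)
    · exact hex x w hx₁ hx₂ hw₁ hw₂ hxw
  rw [sup_comm]
  exact exists_three_cycles_of_common hP₂ hP₁ hd.symm fun a b ha₂ ha₁ hb₂ hb₁ =>
    (key a ha₂ ha₁).symm.trans (key b hb₂ hb₁)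

end Pair

section Orientation

/-- An orientation of `G` in which every vertex has equal out-degree and in-degree. -/
structure IsEulerOrientation (G : SimpleGraph α) (D : α → α → Prop) : Prop where
  adj_iff : ∀ a b, G.Adj a b ↔ D a b ∨ D b a
  asymm : ∀ a b, D a b → ¬ D b a
  balanced : ∀ v, {w | D v w}.ncard = {w | D w v}.ncard

theorem ncard_setOf_or [Finite α] {p q : α → Prop} (h : ∀ w, p w → ¬ q w) :
    {w | p w ∨ q w}.ncard = {w | p w}.ncard + {w | q w}.ncard := by
  rw [Set.ofPred_or, Set.ncard_union_eq _ (Set.toFinite _) (Set.toFinite _)]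
  exact Set.disjoint_left.2 h

theorem IsEulerOrientation.degS_eq [Finite α] {G : SimpleGraph α} {D : α → α → Prop}
    (h : IsEulerOrientation G D) (v : α) : degS G v = 2 * {w | D v w}.ncard := by
  have : G.neighborSet v = {w | D v w ∨ D w v} := Set.ext fun w => h.adj_iff v w
  rw [degS, this, ncard_setOf_or fun w => h.asymm v w, ← h.balanced, two_mul]

theorem IsEulerOrientation.sup [Finite α] {G H : SimpleGraph α} {D E : α → α → Prop}
    (hD : IsEulerOrientation G D) (hE : IsEulerOrientation H E) (hGH : Disjoint G H) :
    IsEulerOrientation (G ⊔ H) fun a b => D a b ∨ E a b := by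
  have hdis : ∀ {a b}, G.Adj a b → H.Adj a b → False := fun h1 h2 =>
    (hGH.le_bot : G ⊓ H ≤ ⊥) (show (G ⊓ H).Adj _ _ from ⟨h1, h2⟩)
  have hG {a b} (h : D a b) : G.Adj a b := (hD.adj_iff a b).2 (Or.inl h)
  have hH {a b} (h : E a b) : H.Adj a b := (hE.adj_iff a b).2 (Or.inl h)
  refine ⟨fun a b => ?_, fun a b => ?_, fun v => ?_⟩
  · rw [sup_adj, hD.adj_iff, hE.adj_iff]
    tauto
  · rintro (h | h) (h' | h')
    · exact hD.asymm _ _ h h'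
    · exact hdis (hG h) (hH h').symm
    · exact hdis (hG h') (hH h).symm
    · exact hE.asymm _ _ h h'
  · rw [ncard_setOf_or fun w h h' => hdis (hG h) (hH h'),
      ncard_setOf_or fun w h h' => hdis (hG h) (hH h'), hD.balanced, hE.balanced]

open Classical in
theorem exists_orientation_of_isTrail [Finite α] {G : SimpleGraph α} {u v : α} {p : G.Walk u v}
    (hp : p.IsTrail) : ∃ D : α → α → Prop, (∀ a b, s(a, b) ∈ p.edges ↔ D a b ∨ D b a) ∧
      (∀ a b, D a b → ¬ D b a) ∧ ∀ x, {w | D x w}.ncard + (if x = v then 1 else 0) =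
        {w | D w x}.ncard + if x = u then 1 else 0 := by
  induction p with
  | nil => exact ⟨fun _ _ => False, by simp, by simp, by simp⟩
  | @cons u w v h p ih =>
    rw [Walk.isTrail_cons] at hp
    obtain ⟨D, hD, has, hb⟩ := ih hp.1
    have hD1 : ¬ D u w := fun h' => hp.2 ((hD _ _).2 (Or.inl h'))
    have hD2 : ¬ D w u := fun h' => hp.2 ((hD _ _).2 (Or.inr h'))
    have huw := h.ne
    refine ⟨fun a b => D a b ∨ (a = u ∧ b = w), fun a b => ?_, fun a b => ?_, fun x => ?_⟩
    · rw [Walk.edges_cons, List.mem_cons, hD, Sym2.eq_iff]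
      tauto
    · rintro (h1 | ⟨rfl, rfl⟩) (h2 | ⟨h3, h4⟩)
      · exact has _ _ h1 h2
      · subst h3 h4; exact hD2 h1
      · exact hD2 h2
      · exact huw h4
    · rw [ncard_setOf_or (by rintro y h1 ⟨rfl, rfl⟩; exact hD1 h1),
        ncard_setOf_or (by rintro y h1 ⟨rfl, rfl⟩; exact hD1 h1)]
      have h1 : {y | x = u ∧ y = w}.ncard = if x = u then 1 else 0 := by
        split_ifs with hx <;> simp [hx]
      have h2 : {y | y = u ∧ x = w}.ncard = if x = w then 1 else 0 := by
        split_ifs with hx <;> simp [hx]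
      have := hb x
      omega

theorem reachable_deleteEdges_of_even [Finite α] {G : SimpleGraph α} (hG : ∀ v, Even (degS G v))
    {p q : α}
    (h : G.Adj p q) : (G.deleteEdges {s(p, q)}).Reachable p q := by
  classical
  have := Fintype.ofFinite α
  change (G \ edge p q).Reachable p q
  by_contra hr
  set K := componentGraph (G \ edge p q) p
  have hdeg : ∀ v, degS (G \ edge p q) v + (if v = p ∨ v = q then 1 else 0) = degS G v := by
    intro v
    rw [← degS_edge h.ne]
    exact degS_sdiff_add (by rw [edge_le_iff]; exact Or.inr h) v
  have hK : ∀ v, degS K v = K.degree v := fun v => by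
    rw [degS, ← Nat.card_coe_set_eq, Nat.card_eq_fintype_card, card_neighborSet_eq_degree]
  have hp : Odd (K.degree p) := by
    rw [← hK, degS_componentGraph_of_reachable .rfl]
    have h1 := hdeg p
    rw [if_pos (Or.inl rfl)] at h1
    have h2 := hG p
    grind
  obtain ⟨w, hwp, hw⟩ := K.exists_ne_odd_degree_of_exists_odd_degree p hp
  rw [← hK] at hw
  by_cases hpw : (G \ edge p q).Reachable p w
  · rw [degS_componentGraph_of_reachable hpw] at hw
    have h1 := hdeg w
    rw [if_neg (by rintro (rfl | rfl) <;> contradiction)] at h1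
    have h2 := hG w
    grind
  · rw [degS_componentGraph_of_not_reachable hpw] at hw
    simp at hw

/-- In an Eulerian graph, every edge lies on a cycle (which has an Eulerian orientation). -/
theorem exists_isCycleGraph_adj [Finite α] {G : SimpleGraph α} (hG : ∀ v, Even (degS G v)) {p q : α}
    (h : G.Adj p q) :
    ∃ C ≤ G, IsCycleGraph C ∧ C.Adj p q ∧ ∃ D, IsEulerOrientation C D := by
  classical
  obtain ⟨u, c, hc, hpq⟩ :=
    adj_and_reachable_delete_edges_iff_exists_cycle.1 ⟨h, reachable_deleteEdges_of_even hG h⟩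
  set C := c.toSubgraph.spanningCoe
  have hadj : ∀ {a b}, C.Adj a b ↔ s(a, b) ∈ c.edges := by
    intro a b
    rw [Subgraph.spanningCoe_adj, Walk.adj_toSubgraph_iff_mem_edges]
  have hC : C.Adj p q := hadj.2 hpq
  have hdeg : ∀ v, degS C v = 0 ∨ v ∈ c.support ∧ degS C v = 2 := by
    intro v
    by_cases hv : v ∈ c.support
    · exact Or.inr ⟨hv, hc.ncard_neighborSet_toSubgraph_eq_two hv⟩
    · left
      rw [degS_eq_zero]
      exact fun w hw => hv (c.fst_mem_support_of_mem_edges (hadj.1 hw))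
  refine ⟨C, Subgraph.spanningCoe_le _, ⟨?_, fun v => (hdeg v).imp_right And.right, ?_⟩, hC, ?_⟩
  · intro hbot
    rw [hbot] at hC
    exact hC
  · intro a b ha hb
    have ha' : a ∈ c.toSubgraph.verts := by
      rw [Walk.mem_verts_toSubgraph]; exact ((hdeg a).resolve_left (by omega)).1
    have hb' : b ∈ c.toSubgraph.verts := by
      rw [Walk.mem_verts_toSubgraph]; exact ((hdeg b).resolve_left (by omega)).1
    have := c.toSubgraph_connected.coe.preconnected ⟨a, ha'⟩ ⟨b, hb'⟩
    exact this.map ⟨Subtype.val, fun h => h⟩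
  · obtain ⟨D, h1, h2, h3⟩ := exists_orientation_of_isTrail hc.isTrail
    exact ⟨D, fun a b => hadj.trans (h1 a b), h2, fun v => Nat.add_right_cancel (h3 v)⟩

theorem even_degS_sdiff [Finite α] {G H : SimpleGraph α} (hG : ∀ v, Even (degS G v))
    (hH : IsPolycycle H)
    (h : H ≤ G) (v : α) : Even (degS (G \ H) v) := by
  have h1 := degS_sdiff_add h v
  have h2 := hG v
  rcases hH v with h3 | h3 <;> grind

theorem exists_isEulerOrientation [Finite α] {G : SimpleGraph α} (hG : ∀ v, Even (degS G v)) :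
    ∃ D, IsEulerOrientation G D := by
  induction G using WellFoundedLT.induction with
  | ind G ih =>
    by_cases hbot : G = ⊥
    · subst hbot
      exact ⟨fun _ _ => False, by simp, by simp, by simp⟩
    obtain ⟨p, q, hpq⟩ := exists_adj_of_ne_bot hbot
    obtain ⟨C, hCG, hC, hadj, D, hD⟩ := exists_isCycleGraph_adj hG hpq
    obtain ⟨E, hE⟩ := ih (G \ C) (lt_of_le_of_ne sdiff_le fun h => by
      rw [← h] at hpq
      exact hpq.2 hadj) (even_degS_sdiff hG hC.2.1 hCG)
    exact ⟨_, by simpa [sdiff_sup_cancel hCG] using hE.sup hD disjoint_sdiff_self_left⟩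

end Orientation

section Peel

theorem exists_perm_of_sum_eq {n : Type*} [Fintype n] [DecidableEq n] {W : n → n → ℕ} {k : ℕ}
    (hrow : ∀ v, ∑ w, W v w = k + 1) (hcol : ∀ w, ∑ v, W v w = k + 1) :
    ∃ σ : Equiv.Perm n, ∀ v, 0 < W v (σ v) := by
  have hk : (k + 1 : ℚ) ≠ 0 := by positivity
  obtain ⟨c, hc0, hc1, hcW⟩ := exists_eq_sum_perm_of_mem_doublyStochastic
    (R := ℚ) (M := Matrix.of fun v w => (W v w : ℚ) / (k + 1)) (by
      rw [mem_doublyStochastic_iff_sum]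
      refine ⟨fun v w => by simp only [Matrix.of_apply]; positivity, fun v => ?_, fun w => ?_⟩
      · simp only [Matrix.of_apply]
        rw [← Finset.sum_div, ← Nat.cast_sum, hrow, Nat.cast_succ, div_self hk]
      · simp only [Matrix.of_apply]
        rw [← Finset.sum_div, ← Nat.cast_sum, hcol, Nat.cast_succ, div_self hk])
  obtain ⟨σ, -, hσ⟩ := Finset.exists_lt_of_sum_lt (s := Finset.univ) (f := fun _ => (0 : ℚ))
    (g := c) (by rw [hc1]; simp)
  refine ⟨σ, fun v => ?_⟩
  have h1 := congrFun (congrFun hcW v) (σ v)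
  rw [Matrix.sum_apply] at h1
  have h2 : c σ ≤ ∑ τ, (c τ • τ.permMatrix ℚ) v (σ v) := by
    refine le_trans ?_ (Finset.single_le_sum (f := fun τ => (c τ • τ.permMatrix ℚ) v (σ v))
      (fun τ _ => ?_) (Finset.mem_univ σ))
    · simp [Equiv.Perm.permMatrix, PEquiv.toMatrix_apply]
    · simp only [Matrix.smul_apply, smul_eq_mul]
      refine mul_nonneg (hc0 τ) ?_
      simp only [Equiv.Perm.permMatrix, PEquiv.toMatrix_apply]
      split_ifs <;> norm_num
  rw [h1, Matrix.of_apply] at h2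
  have h3 : (0 : ℚ) < (W v (σ v) : ℚ) / (k + 1) := lt_of_lt_of_le hσ h2
  by_contra h0
  rw [Nat.eq_zero_of_not_pos h0] at h3
  simp at h3

/-- An Eulerian graph of maximum degree `2 (k + 1)` contains a polycycle covering all vertices of
degree `2 (k + 1)`. -/
theorem exists_isPolycycle_covering [Finite α] {G : SimpleGraph α} (hG : ∀ v, Even (degS G v))
    {k : ℕ}
    (hk : ∀ v, degS G v ≤ 2 * (k + 1)) :
    ∃ P ≤ G, IsPolycycle P ∧ ∀ v, degS G v = 2 * (k + 1) → degS P v = 2 := by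
  classical
  have := Fintype.ofFinite α
  obtain ⟨D, hD⟩ := exists_isEulerOrientation hG
  have hirr : ∀ v, ¬ D v v := fun v h => hD.asymm v v h h
  have hout : ∀ v, ∑ w, (if D v w then 1 else 0) = {w | D v w}.ncard := fun v => by
    rw [Finset.sum_boole, Set.ncard_eq_toFinset_card']; simp
  have hin : ∀ v, ∑ w, (if D w v then 1 else 0) = {w | D w v}.ncard := fun v => by
    rw [Finset.sum_boole, Set.ncard_eq_toFinset_card']; simp
  have hle : ∀ v, {w | D v w}.ncard ≤ k + 1 := fun v => by
    have h1 := hD.degS_eq v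
    have h2 := hk v
    omega
  obtain ⟨σ, hσ⟩ := exists_perm_of_sum_eq (k := k) (W := fun v w =>
      (if D v w then 1 else 0) + if v = w then k + 1 - {w | D v w}.ncard else 0)
    (fun v => by
      have := hle v
      rw [Finset.sum_add_distrib, hout, Finset.sum_ite_eq, if_pos (Finset.mem_univ _)]
      omega)
    (fun v => by
      have := hle v
      rw [Finset.sum_add_distrib, hin, Finset.sum_ite_eq', if_pos (Finset.mem_univ _),
        ← hD.balanced]
      omega)
  have hσD : ∀ v, σ v ≠ v → D v (σ v) := fun v hv => by
    by_contra h
    have := hσ v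
    rw [if_neg h, if_neg (Ne.symm hv)] at this
    exact lt_irrefl _ this
  let P : SimpleGraph α :=
    { Adj := fun a b => a ≠ b ∧ (b = σ a ∨ b = σ.symm a)
      symm := ⟨fun a b h => ⟨h.1.symm, by
        rcases h.2 with rfl | rfl <;> simp⟩⟩
      loopless := ⟨fun _ h => h.1 rfl⟩ }
  have hP2 : ∀ v, σ v ≠ v → degS P v = 2 := fun v hv => by
    have hv' : σ.symm v ≠ v := fun h => hv (by rw [Equiv.symm_apply_eq] at h; exact h.symm)
    rw [degS_eq_two]
    refine ⟨σ v, σ.symm v, fun h => ?_, fun x => ⟨fun h => h.2, ?_⟩⟩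
    · have h1 := hσD v hv
      have h2 := hσD (σ.symm v) (by simpa using hv'.symm)
      rw [Equiv.apply_symm_apply, ← h] at h2
      exact hD.asymm _ _ h1 h2
    · rintro (rfl | rfl)
      · exact ⟨hv.symm, Or.inl rfl⟩
      · exact ⟨hv'.symm, Or.inr rfl⟩
  refine ⟨P, ?_, fun v => ?_, fun v hv => hP2 v fun h => ?_⟩
  · rintro a b ⟨hab, rfl | rfl⟩
    · exact (hD.adj_iff _ _).2 (Or.inl (hσD a hab.symm))
    · have := hσD (σ.symm a) (by simpa using hab)
      rw [Equiv.apply_symm_apply] at this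
      exact (hD.adj_iff _ _).2 (Or.inr this)
  · by_cases hv : σ v = v
    · left
      rw [degS_eq_zero]
      rintro w ⟨hw, rfl | rfl⟩
      · exact hw hv.symm
      · exact hw (by rw [Equiv.eq_symm_apply, hv])
    · exact Or.inr (hP2 v hv)
  · have h1 := hσ v
    have h2 := hD.degS_eq v
    rw [h, if_neg (hirr v), if_pos rfl] at h1
    omega

end Peel

section Assembly

theorem exists_cycles_append {G H : SimpleGraph α} {m n : ℕ} (hHG : H ≤ G)
    (hH : ∃ L : List (SimpleGraph α), L.length ≤ m ∧ (∀ C ∈ L, IsCycleGraph C) ∧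
      listSymmDiff L = H)
    (hGH : ∃ L : List (SimpleGraph α), L.length ≤ n ∧ (∀ C ∈ L, IsCycleGraph C) ∧
      listSymmDiff L = G \ H) :
    ∃ L : List (SimpleGraph α), L.length ≤ m + n ∧ (∀ C ∈ L, IsCycleGraph C) ∧
      listSymmDiff L = G := by
  obtain ⟨L, hL, hLC, rfl⟩ := hH
  obtain ⟨L', hL', hLC', hG⟩ := hGH
  refine ⟨L ++ L', by simpa using add_le_add hL hL', fun C hC => ?_, ?_⟩
  · rw [List.mem_append] at hC
    exact hC.elim (hLC C) (hLC' C)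
  · rw [listSymmDiff_append, hG, Disjoint.symmDiff_eq_sup disjoint_sdiff_self_right,
      sup_sdiff_cancel_right hHG]

theorem degS_sdiff_le [Finite α] {G P : SimpleGraph α} (hPG : P ≤ G) (hG : ∀ v, Even (degS G v))
    {k : ℕ}
    (hk : ∀ v, degS G v ≤ 2 * (k + 1)) (hP : ∀ v, degS G v = 2 * (k + 1) → degS P v = 2) (v : α) :
    degS (G \ P) v ≤ 2 * k := by
  have h1 := degS_sdiff_add hPG v
  have h2 := hG v
  have h3 := hk v
  have h4 := hP v
  grind

/-- An Eulerian graph of maximum degree at most `2 k` has a cycle odd-cover of size at most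
`k + ⌈k / 2⌉`. -/
theorem exists_cycles_of_degS_le [Finite α] (k : ℕ) {G : SimpleGraph α} (hG : ∀ v, Even (degS G v))
    (hk : ∀ v, degS G v ≤ 2 * k) :
    ∃ L : List (SimpleGraph α), L.length ≤ k + (k + 1) / 2 ∧ (∀ C ∈ L, IsCycleGraph C) ∧
      listSymmDiff L = G := by
  induction k using Nat.twoStepInduction generalizing G with
  | zero =>
    have : G = ⊥ := by
      by_contra h
      obtain ⟨p, q, hpq⟩ := exists_adj_of_ne_bot h
      have h1 := degS_pos_of_adj hpq
      have h2 := hk p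
      omega
    exact ⟨[], by simp, by simp, this.symm⟩
  | one =>
    refine exists_two_cycles_of_isPolycycle fun v => ?_
    have h1 := hG v
    have h2 := hk v
    grind
  | more k ih _ =>
    obtain ⟨P₁, hP₁G, hP₁, hcov₁⟩ := exists_isPolycycle_covering hG (k := k + 1) hk
    have hG₁ := even_degS_sdiff hG hP₁ hP₁G
    have hk₁ := degS_sdiff_le hP₁G hG hk hcov₁
    obtain ⟨P₂, hP₂G, hP₂, hcov₂⟩ := exists_isPolycycle_covering hG₁ hk₁
    have hG₂ := even_degS_sdiff hG₁ hP₂ hP₂G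
    have hk₂ := degS_sdiff_le hP₂G hG₁ hk₁ hcov₂
    rw [sdiff_sdiff_left] at hG₂ hk₂
    obtain ⟨L, hL, hcov⟩ := exists_cycles_append
      (sup_le hP₁G (hP₂G.trans sdiff_le)) (exists_three_cycles_of_isPolycycle hP₁ hP₂
        (disjoint_sdiff_self_right.mono_right hP₂G)) (ih hG₂ hk₂)
    exact ⟨L, by omega, hcov⟩

/-- If all vertices of an Eulerian graph except possibly `u` have degree at most `2 k`, and `u` has
degree at most `2 (k + j)`, then `j` additional cycles suffice. -/
theorem exists_cycles_of_degS_le_of_ne [Finite α] (j : ℕ) {G : SimpleGraph α} {k : ℕ} {u : α}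
    (hG : ∀ v, Even (degS G v)) (hu : degS G u ≤ 2 * (k + j))
    (hk : ∀ v, v ≠ u → degS G v ≤ 2 * k) :
    ∃ L : List (SimpleGraph α), L.length ≤ j + (k + (k + 1) / 2) ∧ (∀ C ∈ L, IsCycleGraph C) ∧
      listSymmDiff L = G := by
  induction j generalizing G with
  | zero =>
    rw [zero_add]
    refine exists_cycles_of_degS_le k hG fun v => ?_
    by_cases hv : v = u
    · exact hv ▸ hu
    · exact hk v hv
  | succ j ih =>
    by_cases hu' : degS G u ≤ 2 * (k + j)
    · obtain ⟨L, hL, hL'⟩ := ih hG hu' hk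
      exact ⟨L, by omega, hL'⟩
    obtain ⟨q, hq⟩ := degS_pos.1 (show 0 < degS G u by omega)
    obtain ⟨C, hCG, hC, hadj, -⟩ := exists_isCycleGraph_adj hG hq
    have hCu : degS C u = 2 := (hC.2.1 u).resolve_left (degS_pos_of_adj hadj).ne'
    have hdeg := degS_sdiff_add hCG u
    obtain ⟨L, hL, hL'⟩ := exists_cycles_append (m := 1) hCG
      ⟨[C], le_rfl, by simpa using hC, by simp [listSymmDiff]⟩
      (ih (even_degS_sdiff hG hC.2.1 hCG) (by omega)
        fun v hv => (degS_mono sdiff_le v).trans (hk v hv))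
    exact ⟨L, by omega, hL'⟩

end Assembly

end CycleOddCover

/-- Every Eulerian graph on at least two vertices with largest degree `d₁`
(attained at `u`) and second-largest degree `d₂` admits a cycle odd-cover of
size at most `d₁/2 + ⌈d₂/4⌉`; in particular, of size at most `⌈3Δ(G)/4⌉`. -/
theorem cycle_oddCover_general
    {α : Type*} [Fintype α] [DecidableEq α] (G : SimpleGraph α)
    (hcard : 2 ≤ Fintype.card α)
    (hEuler : ∀ v, Even (degS G v))
    (u : α) (hu : ∀ v, degS G v ≤ degS G u) :
    (∃ L : List (SimpleGraph α),
        L.length ≤ degS G u / 2 + ((Finset.univ.erase u).sup (degS G) + 3) / 4 ∧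
        (∀ C ∈ L, IsCycleGraph C) ∧ listSymmDiff L = G) ∧
    (∃ L : List (SimpleGraph α),
        L.length ≤ (3 * degS G u + 3) / 4 ∧
        (∀ C ∈ L, IsCycleGraph C) ∧ listSymmDiff L = G) := by
  have hne : (Finset.univ.erase u).Nonempty := by
    rw [← Finset.card_pos, Finset.card_erase_of_mem (Finset.mem_univ u), Finset.card_univ]
    omega
  obtain ⟨v, -, hv⟩ := Finset.exists_mem_eq_sup _ hne (degS G)
  obtain ⟨k₁, hk₁⟩ := hEuler u
  obtain ⟨k₂, hk₂⟩ := hEuler v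
  have hle : degS G v ≤ degS G u := hu v
  obtain ⟨L, hL, hL'⟩ := CycleOddCover.exists_cycles_of_degS_le_of_ne (k₁ - k₂) (k := k₂) hEuler
    (u := u) (by omega) (fun w hw => by
      have := Finset.le_sup (f := degS G) (Finset.mem_erase.2 ⟨hw, Finset.mem_univ w⟩)
      omega)
  exact ⟨⟨L, by omega, hL'⟩, ⟨L, by omega, hL'⟩⟩
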